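/- arXiv:1708.03996 — 3 statements merged into one kernel-verified Lean document; each statement's English description precedes it below -/
import Mathlib

section
/- Let n be a positive even integer and let x be an integer with 0.454·n < x ≤ 0.45537·n. Then the number of pairings F ∈ G'_16(n) such that π(F) has a MAI set A whose largest independent subset has size x (equivalently, with α(π(F)) = x) is at most q(x,n). -/
/-- A set of vertices is independent if its vertices are pairwise nonadjacent. -/
def IsIndep {V : Type*} (G : SimpleGraph V) (s : Set V) : Prop :=
  s.Pairwise fun u v => ¬ G.Adj u v

/-- The independence number of a graph: the largest size of an independent set. -/
noncomputable def indepNum {V : Type*} (G : SimpleGraph V) : ℕ :=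
  sSup {n | ∃ s : Set V, IsIndep G s ∧ s.ncard = n}

/-- A graph is cubic (3-regular) if every vertex has exactly three neighbors. -/
def IsCubic {V : Type*} (G : SimpleGraph V) : Prop :=
  ∀ v : V, (G.neighborSet v).ncard = 3

/-- `A` is an AI set (almost independent set) if the subgraph induced by `A` has maximum
degree at most 1, i.e. every vertex of `A` has at most one neighbor inside `A`. -/
def IsAI {V : Type*} (G : SimpleGraph V) (A : Set V) : Prop :=
  ∀ a ∈ A, ({b | b ∈ A ∧ G.Adj a b}).ncard ≤ 1

/-- `A` is a MAI set (maximum almost independent set) if `A` is an AI set containing an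
independent set of maximum size `α(G)`, and `A` is largest among such sets. -/
def IsMAI {V : Type*} (G : SimpleGraph V) (A : Set V) : Prop :=
  IsAI G A ∧ (∃ s ⊆ A, IsIndep G s ∧ s.ncard = indepNum G) ∧
    ∀ A' : Set V, IsAI G A' → (∃ s ⊆ A', IsIndep G s ∧ s.ncard = indepNum G) →
      A'.ncard ≤ A.ncard
/-- A pairing (configuration) on the point set `W_n = Fin n × Fin 3` is a perfect matching of
the `3n` points, encoded as a fixed-point-free involution `σ`; there are `(3n−1)!!` of them. -/
def IsPairing {n : ℕ} (σ : Fin n × Fin 3 → Fin n × Fin 3) : Prop :=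
  (∀ p, σ (σ p) = p) ∧ ∀ p, σ p ≠ p

/-- The projection `π(F)` of a pairing: distinct vertices `u, v` are adjacent iff some point
of `u` is matched with some point of `v`. -/
def projGraph {n : ℕ} (σ : Fin n × Fin 3 → Fin n × Fin 3) : SimpleGraph (Fin n) :=
  SimpleGraph.fromRel fun u v => ∃ j k : Fin 3, σ (u, j) = (v, k)

/-- The projected multigraph of `σ` is a simple graph: no loops (no point is matched to a
point of the same vertex) and no multiple edges (distinct points of a vertex are matched to
points of distinct vertices). -/
def ProjIsSimple {n : ℕ} (σ : Fin n × Fin 3 → Fin n × Fin 3) : Prop :=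
  (∀ p : Fin n × Fin 3, (σ p).1 ≠ p.1) ∧
    ∀ (v : Fin n) (j k : Fin 3), (σ (v, j)).1 = (σ (v, k)).1 → j = k

/-- `F ∈ G'_16(n)`: `F` is a pairing whose projection is a simple graph of girth at least 16
(such a projection is automatically a cubic graph). -/
def MemGSixteen {n : ℕ} (σ : Fin n × Fin 3 → Fin n × Fin 3) : Prop :=
  IsPairing σ ∧ ProjIsSimple σ ∧ 16 ≤ (projGraph σ).egirth
/-- The quantity `q(x,n)` from Lemma 8 (all subtractions below are truncated natural
subtraction; for `0.454·n < x ≤ 0.45537·n` and indices in the given ranges every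
subtraction is of a nonnegative quantity). -/
noncomputable def qfun (x n : ℕ) : ℝ :=
  ∑ i ∈ Finset.range (n / 2 - x + 1), ∑ j ∈ Finset.range (n - 2 * x - 2 * i + 1),
    (n.choose (n / 2 - i) : ℝ) *
      (((n / 2 - i).factorial : ℝ) * (3 : ℝ) ^ (n - 2 * x - 2 * i) /
        (((2 * x + i - n / 2).factorial : ℝ) * (2 : ℝ) ^ (n / 2 - x - i) *
          ((n / 2 - x - i).factorial : ℝ))) *
      (((n / 2 + i).factorial : ℝ) * (3 : ℝ) ^ (n - 2 * x + 4 * i) /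
        (((2 * x - 3 * i - n / 2).factorial : ℝ) * (2 : ℝ) ^ (n / 2 - x + 2 * i) *
          ((n / 2 - x + 2 * i).factorial : ℝ))) *
      ((n - 2 * i - 2 * x).choose j : ℝ) * ((n - 2 * x + 4 * i).choose j : ℝ) *
      (2 : ℝ) ^ (2 * j) * (j.factorial : ℝ) * (1 / 1.618 : ℝ) ^ j *
      (((3 * (2 * x - n / 2 - 3 * i)).factorial : ℝ) *
          ((3 * (2 * x - n / 2 + i)).factorial : ℝ) /
        ((3 * (2 * x - n / 2 - 3 * i) - 2 * (n - 2 * i - 2 * x) + j).factorial : ℝ))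

/-- A fixed-point-free involution splits its domain into pairs. -/
theorem exists_pairing_equiv {J : Type*} [Fintype J] (α : J → J) (hα : Function.Involutive α)
    (hne : ∀ v, α v ≠ v) :
    ∃ (X : Finset J) (e : X × Bool ≃ J), ∀ v s, α (e (v, s)) = e (v, !s) := by
  classical
  let r := Fintype.equivFin J
  let X : Finset J := Finset.univ.filter fun v => r v < r (α v)
  have hX : ∀ v, v ∉ X → α v ∈ X := by
    intro v hv
    simp only [X, Finset.mem_filter, Finset.mem_univ, true_and, not_lt] at hv ⊢
    rw [hα v]
    exact lt_of_le_of_ne hv fun h => hne v (r.injective h)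
  have hX' : ∀ v, v ∈ X → α v ∉ X := by
    intro v hv
    simp only [X, Finset.mem_filter, Finset.mem_univ, true_and, not_lt] at hv ⊢
    rw [hα v]
    exact hv.le
  let f : X × Bool → J := fun p => if p.2 then α p.1 else p.1
  have hf : Function.Bijective f := by
    constructor
    · rintro ⟨⟨u, hu⟩, s⟩ ⟨⟨v, hv⟩, t⟩ h
      have h1 := hX' u hu
      have h2 := hX' v hv
      cases s <;> cases t <;> simp only [f, if_true, Bool.false_eq_true, if_false] at h
      · simp [h]
      · exact absurd hu (h ▸ h2)
      · exact absurd hv (h ▸ h1)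
      · simp [hα.injective h]
    · intro v
      by_cases hv : v ∈ X
      · exact ⟨(⟨v, hv⟩, false), by simp [f]⟩
      · exact ⟨(⟨α v, hX v hv⟩, true), by simp [f, hα v]⟩
  refine ⟨X, Equiv.ofBijective f hf, ?_⟩
  rintro ⟨v, hv⟩ s
  cases s <;> simp [f, hα v]

/-- The eigenvalues of the hard-core transfer matrix. -/
noncomputable def hardCoreEigenvalue (c : Bool) : ℝ :=
  if c then Real.goldenRatio else Real.goldenConj

/-- Eigenvectors of the hard-core transfer matrix. -/
noncomputable def hardCoreVec (c a : Bool) : ℝ := if a then 1 else hardCoreEigenvalue c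

/-- The coefficients of the spectral decomposition of the hard-core transfer matrix. -/
noncomputable def hardCoreCoeff (c : Bool) : ℝ :=
  hardCoreEigenvalue c / (hardCoreEigenvalue c ^ 2 + 1)

theorem hardCore_spectral (a b : Bool) :
    (if a && b then (0 : ℝ) else 1) =
      ∑ c, hardCoreCoeff c * (hardCoreVec c a * hardCoreVec c b) := by
  have h1 := Real.goldenRatio_sq
  have h2 := Real.goldenConj_sq
  have h3 := Real.goldenRatio_mul_goldenConj
  have h4 := Real.goldenRatio_add_goldenConj
  have e1 : Real.goldenConj = 1 - Real.goldenRatio := by linarith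
  have p1 : Real.goldenRatio ^ 2 + 1 ≠ 0 := by positivity
  have p2 : Real.goldenConj ^ 2 + 1 ≠ 0 := by positivity
  rw [e1] at p2
  cases a <;> cases b <;>
    simp only [Fintype.sum_bool, hardCoreCoeff, hardCoreVec, hardCoreEigenvalue, e1] <;>
    simp <;> field_simp <;> generalize Real.goldenRatio = y at * <;>
    grind

theorem hardCoreVec_orthogonal (c d : Bool) :
    ∑ a, hardCoreVec c a * hardCoreVec d a =
      if c = d then hardCoreEigenvalue c ^ 2 + 1 else 0 := by
  have h3 := Real.goldenRatio_mul_goldenConj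
  cases c <;> cases d <;>
    simp only [Fintype.sum_bool, hardCoreVec, hardCoreEigenvalue] <;> simp <;>
    nlinarith [Real.goldenRatio_sq, Real.goldenConj_sq]

theorem prod_eq_sum_of_pairing {J X : Type*} [Fintype J] [Fintype X] [DecidableEq X]
    (e : X × Bool ≃ J)
    (x : J → Bool) :
    ∏ v : X, (if x (e (v, false)) && x (e (v, true)) then (0 : ℝ) else 1) =
      ∑ z : X → Bool, (∏ v, hardCoreCoeff (z v)) *
        ∏ v, hardCoreVec (z (e.symm v).1) (x v) := by
  simp_rw [hardCore_spectral]
  rw [Finset.prod_univ_sum, Fintype.piFinset_univ]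
  refine Finset.sum_congr rfl fun z _ => ?_
  rw [Finset.prod_mul_distrib]
  congr 1
  rw [← e.prod_comp, Fintype.prod_prod_type]
  simp [mul_comm]

theorem prod_hardCoreCoeff_mul_nonneg {J X Y : Type*} [Fintype J] [Fintype X] [Fintype Y]
    (e : X × Bool ≃ J) (f : Y × Bool ≃ J) (z : X → Bool) (y : Y → Bool)
    (h : ∀ v, z (e.symm v).1 = y (f.symm v).1) :
    0 ≤ (∏ v, hardCoreCoeff (z v)) * ∏ v, hardCoreCoeff (y v) := by
  let s : Bool → ℕ := fun c => if c then 0 else 1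
  have hs : ∀ c, hardCoreCoeff c = (-1) ^ s c * |hardCoreCoeff c| := by
    intro c
    cases c
    · have : hardCoreCoeff false ≤ 0 := by
        simp only [hardCoreCoeff, hardCoreEigenvalue]
        exact div_nonpos_of_nonpos_of_nonneg Real.goldenConj_neg.le (by positivity)
      simp [s, abs_of_nonpos this]
    · have : 0 ≤ hardCoreCoeff true := by
        simp only [hardCoreCoeff, hardCoreEigenvalue]
        have := Real.goldenRatio_pos
        simp only [if_true]
        positivity
      simp [s, abs_of_nonneg this]
  have hsum : ∑ v, s (z v) = ∑ v, s (y v) := by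
    have h1 : ∑ v, s (z (e.symm v).1) = 2 * ∑ v, s (z v) := by
      rw [← e.sum_comp, Fintype.sum_prod_type]
      simp [Finset.mul_sum, two_mul]
    have h2 : ∑ v, s (y (f.symm v).1) = 2 * ∑ v, s (y v) := by
      rw [← f.sum_comp, Fintype.sum_prod_type]
      simp [Finset.mul_sum, two_mul]
    simp_rw [h] at h1
    omega
  have hz : ∏ v, hardCoreCoeff (z v) = (-1) ^ (∑ v, s (z v)) * ∏ v, |hardCoreCoeff (z v)| := by
    rw [← Finset.prod_pow_eq_pow_sum, ← Finset.prod_mul_distrib]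
    exact Finset.prod_congr rfl fun v _ => hs _
  have hy : ∏ v, hardCoreCoeff (y v) = (-1) ^ (∑ v, s (y v)) * ∏ v, |hardCoreCoeff (y v)| := by
    rw [← Finset.prod_pow_eq_pow_sum, ← Finset.prod_mul_distrib]
    exact Finset.prod_congr rfl fun v _ => hs _
  rw [hz, hy, hsum, mul_mul_mul_comm, ← mul_pow]
  norm_num
  positivity

/-- A union of two perfect matchings on `J` has at least `φ ^ |J|` independent sets. -/
theorem goldenRatio_pow_le_card_of_fixedPointFree {J : Type*} [Fintype J] [DecidableEq J]
    (α β : J → J)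
    (hα : Function.Involutive α) (hα' : ∀ v, α v ≠ v)
    (hβ : Function.Involutive β) (hβ' : ∀ v, β v ≠ v) :
    Real.goldenRatio ^ Fintype.card J ≤
      (Finset.univ.filter fun x : J → Bool =>
        ∀ v, (x v && x (α v)) = false ∧ (x v && x (β v)) = false).card := by
  obtain ⟨X, e, he⟩ := exists_pairing_equiv α hα hα'
  obtain ⟨Y, f, hf⟩ := exists_pairing_equiv β hβ hβ'
  have hind : ∀ (α : J → J) (X : Finset J) (e : X × Bool ≃ J)
      (he : ∀ v s, α (e (v, s)) = e (v, !s)) (x : J → Bool),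
      ∏ v : X, (if x (e (v, false)) && x (e (v, true)) then (0 : ℝ) else 1) =
        if ∀ v, (x v && x (α v)) = false then 1 else 0 := by
    intro α X e he x
    split_ifs with h
    · refine Finset.prod_eq_one fun v _ => ?_
      have := h (e (v, false))
      rw [he] at this
      simp only [Bool.not_false] at this
      simp [this]
    · push Not at h
      obtain ⟨v, hv⟩ := h
      obtain ⟨⟨u, s⟩, rfl⟩ := e.surjective v
      rw [he] at hv
      refine Finset.prod_eq_zero (Finset.mem_univ u) ?_
      cases s <;> simp_all
  have hcard : ((Finset.univ.filter fun x : J → Bool =>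
        ∀ v, (x v && x (α v)) = false ∧ (x v && x (β v)) = false).card : ℝ) =
      ∑ x : J → Bool,
        (∏ v : X, (if x (e (v, false)) && x (e (v, true)) then (0 : ℝ) else 1)) *
        ∏ v : Y, (if x (f (v, false)) && x (f (v, true)) then (0 : ℝ) else 1) := by
    rw [Finset.card_filter]
    push_cast
    refine Finset.sum_congr rfl fun x _ => ?_
    rw [hind α X e he, hind β Y f hf]
    simp only [forall_and]
    split_ifs <;> simp_all
  rw [hcard]
  simp_rw [prod_eq_sum_of_pairing e, prod_eq_sum_of_pairing f, Finset.sum_mul_sum]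
  rw [Finset.sum_comm]
  refine le_of_le_of_eq ?_ (Finset.sum_congr rfl fun z _ => Finset.sum_comm).symm
  have hterm : ∀ (z : X → Bool) (y : Y → Bool),
      ∑ x : J → Bool, ((∏ v, hardCoreCoeff (z v)) *
        ∏ v, hardCoreVec (z (e.symm v).1) (x v)) * ((∏ v, hardCoreCoeff (y v)) *
        ∏ v, hardCoreVec (y (f.symm v).1) (x v)) =
      ((∏ v, hardCoreCoeff (z v)) * ∏ v, hardCoreCoeff (y v)) *
        ∏ v : J, if z (e.symm v).1 = y (f.symm v).1 then
          hardCoreEigenvalue (z (e.symm v).1) ^ 2 + 1 else 0 := by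
    intro z y
    simp_rw [← hardCoreVec_orthogonal]
    rw [Finset.prod_univ_sum, Fintype.piFinset_univ, Finset.mul_sum]
    refine Finset.sum_congr rfl fun x _ => ?_
    rw [mul_mul_mul_comm, ← Finset.prod_mul_distrib]
  simp_rw [hterm]
  have hnn : ∀ (z : X → Bool) (y : Y → Bool),
      0 ≤ ((∏ v, hardCoreCoeff (z v)) * ∏ v, hardCoreCoeff (y v)) *
        ∏ v : J, if z (e.symm v).1 = y (f.symm v).1 then
          hardCoreEigenvalue (z (e.symm v).1) ^ 2 + 1 else 0 := by
    intro z y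
    by_cases h : ∀ v, z (e.symm v).1 = y (f.symm v).1
    · refine mul_nonneg (prod_hardCoreCoeff_mul_nonneg e f z y h)
        (Finset.prod_nonneg fun v _ => ?_)
      split_ifs <;> positivity
    · push Not at h
      obtain ⟨v, hv⟩ := h
      rw [Finset.prod_eq_zero (Finset.mem_univ v) (by simp [hv]), mul_zero]
  refine le_trans ?_ (Finset.single_le_sum
    (fun z _ => Finset.sum_nonneg fun y _ => hnn z y) (Finset.mem_univ fun _ => true))
  refine le_trans ?_ (Finset.single_le_sum (fun y _ => hnn _ y) (Finset.mem_univ fun _ => true))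
  have hX : Fintype.card J = Fintype.card X * 2 := by
    rw [← Fintype.card_congr e, Fintype.card_prod, Fintype.card_bool]
  have hY : Fintype.card J = Fintype.card Y * 2 := by
    rw [← Fintype.card_congr f, Fintype.card_prod, Fintype.card_bool]
  have hXY : Fintype.card Y = Fintype.card X := by omega
  simp only [Finset.prod_const, Finset.card_univ, if_true, hXY]
  rw [hX, ← pow_add, ← mul_two, ← mul_pow]
  apply le_of_eq
  congr 1
  simp only [hardCoreCoeff, hardCoreEigenvalue, if_true]
  have : Real.goldenRatio ^ 2 + 1 ≠ 0 := by positivity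
  field_simp

/-- A graph on `J` whose edges are the nontrivial orbits of two involutions has at least
`φ ^ |J|` independent sets. -/
theorem goldenRatio_pow_le_card_of_involutive {J : Type*} [Fintype J] [DecidableEq J]
    (α β : J → J) (hα : Function.Involutive α) (hβ : Function.Involutive β) :
    Real.goldenRatio ^ Fintype.card J ≤
      (Finset.univ.filter fun x : J → Bool =>
        ∀ v, (α v ≠ v → (x v && x (α v)) = false) ∧
          (β v ≠ v → (x v && x (β v)) = false)).card := by
  let d : (J → J) → J × Bool → J × Bool := fun γ p =>
    if γ p.1 = p.1 then (p.1, !p.2) else (γ p.1, p.2)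
  have hd : ∀ γ : J → J, Function.Involutive γ → Function.Involutive (d γ) := by
    rintro γ hγ ⟨v, s⟩
    by_cases h : γ v = v
    · simp [d, h]
    · simp [d, h, hγ v, Ne.symm h]
  have hd' : ∀ (γ : J → J) (p : J × Bool), d γ p ≠ p := by
    rintro γ ⟨v, s⟩
    by_cases h : γ v = v <;> simp [d, h]
  have key := goldenRatio_pow_le_card_of_fixedPointFree (d α) (d β) (hd α hα) (hd' α)
    (hd β hβ) (hd' β)
  set S := Finset.univ.filter fun x : J → Bool =>
        ∀ v, (α v ≠ v → (x v && x (α v)) = false) ∧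
          (β v ≠ v → (x v && x (β v)) = false) with hS
  have hle : (Finset.univ.filter fun x : J × Bool → Bool =>
        ∀ v, (x v && x (d α v)) = false ∧ (x v && x (d β v)) = false).card ≤
      (S ×ˢ S).card := by
    refine Finset.card_le_card_of_injOn
      (fun x => (fun v => x (v, false), fun v => x (v, true))) ?_ ?_
    · intro x hx
      simp only [Finset.coe_filter, Finset.mem_univ, true_and, Set.mem_ofPred_eq] at hx
      have hmem : ∀ s, (fun v => x (v, s)) ∈ S := by
        intro s
        simp only [hS, Finset.mem_filter, Finset.mem_univ, true_and]
        intro v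
        have := hx (v, s)
        constructor
        · intro h
          simpa only [d, h, if_false] using this.1
        · intro h
          simpa only [d, h, if_false] using this.2
      simpa using ⟨hmem false, hmem true⟩
    · intro x _ y _ h
      simp only [Prod.mk.injEq] at h
      funext ⟨v, s⟩
      cases s
      · exact congrFun h.1 v
      · exact congrFun h.2 v
  rw [Finset.card_product, ← sq] at hle
  rw [Fintype.card_prod, Fintype.card_bool, pow_mul] at key
  refine (sq_le_sq₀ (pow_nonneg Real.goldenRatio_pos.le _) (Nat.cast_nonneg _)).mp
    (key.trans ?_)
  exact_mod_cast hle

/-- A graph whose edges are covered by two matchings has at least `φ ^ |J|` independent sets. -/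
theorem goldenRatio_pow_le_card_of_matchings {V : Type*} [DecidableEq V] (J : Finset V)
    (R T : V → V → Prop) [DecidableRel R] [DecidableRel T]
    (hR : ∀ u v, R u v → R v u) (hR' : ∀ u ∈ J, ∀ v ∈ J, ∀ w ∈ J, R u v → R u w → v = w)
    (hT : ∀ u v, T u v → T v u) (hT' : ∀ u ∈ J, ∀ v ∈ J, ∀ w ∈ J, T u v → T u w → v = w) :
    Real.goldenRatio ^ J.card ≤
      (J.powerset.filter fun S => ∀ u ∈ S, ∀ v ∈ S, u ≠ v → ¬ R u v ∧ ¬ T u v).card := by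
  classical
  have hinv : ∀ R : V → V → Prop, (∀ u v, R u v → R v u) →
      (∀ u ∈ J, ∀ v ∈ J, ∀ w ∈ J, R u v → R u w → v = w) →
      ∃ α : J → J, Function.Involutive α ∧ ∀ u v : J, u ≠ v → (R u v ↔ α u = v) := by
    intro R hR hR'
    let α : J → J := fun u => if h : ∃ v : J, v ≠ u ∧ R u v then h.choose else u
    have h1 : ∀ u v : J, u ≠ v → R u v → α u = v := by
      intro u v huv h
      have hex : ∃ v : J, v ≠ u ∧ R u v := ⟨v, huv.symm, h⟩
      have : α u = hex.choose := dif_pos hex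
      rw [this]
      exact Subtype.ext (hR' u u.2 _ hex.choose.2 v v.2 hex.choose_spec.2 h)
    have h2 : ∀ u : J, α u ≠ u → R u (α u) := by
      intro u hu
      by_cases hex : ∃ v : J, v ≠ u ∧ R u v
      · have : α u = hex.choose := dif_pos hex
        rw [this]
        exact hex.choose_spec.2
      · exact absurd (dif_neg hex) hu
    refine ⟨α, fun u => ?_, fun u v huv => ⟨h1 u v huv, ?_⟩⟩
    · by_cases hu : α u = u
      · rw [hu, hu]
      · exact h1 _ _ hu (hR _ _ (h2 u hu))
    · rintro rfl
      exact h2 u huv.symm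
  obtain ⟨α, hα, hα'⟩ := hinv R hR hR'
  obtain ⟨β, hβ, hβ'⟩ := hinv T hT hT'
  have key := goldenRatio_pow_le_card_of_involutive α β hα hβ
  rw [Fintype.card_coe] at key
  refine key.trans ?_
  norm_cast
  refine Finset.card_le_card_of_injOn
    (fun x => (Finset.univ.filter fun v : J => x v = true).map (Function.Embedding.subtype _)) ?_ ?_
  · intro x hx
    simp only [Finset.coe_filter, Finset.mem_univ, true_and, Set.mem_ofPred_eq] at hx
    simp only [Finset.coe_filter, Finset.mem_powerset, Set.mem_ofPred_eq]
    constructor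
    · intro v hv
      simp only [Finset.mem_map, Function.Embedding.subtype_apply] at hv
      obtain ⟨w, _, rfl⟩ := hv
      exact w.2
    · intro u hu v hv huv
      simp only [Finset.mem_map, Function.Embedding.subtype_apply, Finset.mem_filter,
        Finset.mem_univ, true_and] at hu hv
      obtain ⟨u, hu, rfl⟩ := hu
      obtain ⟨v, hv, rfl⟩ := hv
      have huv' : u ≠ v := fun h => huv (congrArg _ h)
      rw [hα' u v huv', hβ' u v huv']
      constructor
      · rintro rfl
        simpa [hu, hv] using (hx u).1 huv'.symm
      · rintro rfl
        simpa [hu, hv] using (hx u).2 huv'.symm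
  · intro x _ y _ h
    have := Finset.map_injective _ h
    funext v
    have hv := Finset.ext_iff.mp this v
    simp only [Finset.mem_filter, Finset.mem_univ, true_and] at hv
    exact Bool.eq_iff_iff.mpr hv

/-- A subcubic graph without cycles of length at most 5. -/
structure ShortCycleFree {V : Type*} (G : SimpleGraph V) : Prop where
  subcubic : ∀ v a b c d, G.Adj v a → G.Adj v b → G.Adj v c → G.Adj v d →
    a ≠ b → a ≠ c → a ≠ d → b ≠ c → b ≠ d → c ≠ d → False
  tri : ∀ a b c, G.Adj a b → G.Adj b c → G.Adj c a → False
  quad : ∀ a b c d, G.Adj a b → G.Adj b c → G.Adj c d → G.Adj d a → a ≠ c → b ≠ d → False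
  pent : ∀ a b c d e, G.Adj a b → G.Adj b c → G.Adj c d → G.Adj d e → G.Adj e a → False

/-- The `Finset` form of `IsMAI`, with the independence number as a parameter. -/
structure IsMaxAI {V : Type*} (G : SimpleGraph V) (α : ℕ) (A : Finset V) : Prop where
  ai : ∀ a ∈ A, ∀ b ∈ A, ∀ c ∈ A, G.Adj a b → G.Adj a c → b = c
  indep : ∃ I ⊆ A, (∀ u ∈ I, ∀ v ∈ I, ¬ G.Adj u v) ∧ I.card = α
  card_le : ∀ I : Finset V, (∀ u ∈ I, ∀ v ∈ I, ¬ G.Adj u v) → I.card ≤ α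
  max : ∀ B : Finset V, (∀ a ∈ B, ∀ b ∈ B, ∀ c ∈ B, G.Adj a b → G.Adj a c → b = c) →
    (∃ I ⊆ B, (∀ u ∈ I, ∀ v ∈ I, ¬ G.Adj u v) ∧ I.card = α) → B.card ≤ A.card

section MaxAI

variable {V : Type*} [DecidableEq V] {G : SimpleGraph V} {α : ℕ} {A : Finset V}

/-- A maximum independent subset can be chosen to avoid any set of matched vertices containing
no matched pair. -/
theorem IsMaxAI.exists_indep_avoiding (h : IsMaxAI G α A) (R : Finset V) (hRA : R ⊆ A)
    (hR : ∀ r ∈ R, ∃ m ∈ A, G.Adj r m ∧ m ∉ R) :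
    ∃ I ⊆ A \ R, (∀ u ∈ I, ∀ v ∈ I, ¬ G.Adj u v) ∧ I.card = α := by
  classical
  obtain ⟨I, hIA, hI, hcard⟩ := h.indep
  choose! m hmA hadj hmR using hR
  have hback : ∀ r ∈ R, ∀ u ∈ A, G.Adj (m r) u → u = r := fun r hr u hu hu' =>
    h.ai (m r) (hmA r hr) u hu r (hRA hr) hu' (hadj r hr).symm
  refine ⟨(I \ R) ∪ (I ∩ R).image m, ?_, ?_, ?_⟩
  · intro v hv
    simp only [Finset.mem_union, Finset.mem_sdiff, Finset.mem_image, Finset.mem_inter] at hv ⊢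
    rcases hv with ⟨h1, h2⟩ | ⟨r, ⟨_, hr⟩, rfl⟩
    · exact ⟨hIA h1, h2⟩
    · exact ⟨hmA r hr, hmR r hr⟩
  · have key : ∀ u ∈ I \ R, ∀ v ∈ (I ∩ R).image m, ¬ G.Adj u v := by
      intro u hu v hv huv
      simp only [Finset.mem_sdiff, Finset.mem_image, Finset.mem_inter] at hu hv
      obtain ⟨r, ⟨_, hr⟩, rfl⟩ := hv
      exact hu.2 (hback r hr u (hIA hu.1) huv.symm ▸ hr)
    intro u hu v hv huv
    rcases Finset.mem_union.mp hu with hu | hu <;> rcases Finset.mem_union.mp hv with hv | hv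
    · exact hI u (Finset.mem_sdiff.mp hu).1 v (Finset.mem_sdiff.mp hv).1 huv
    · exact key u hu v hv huv
    · exact key v hv u hu huv.symm
    · simp only [Finset.mem_image, Finset.mem_inter] at hu hv
      obtain ⟨r, ⟨_, hr⟩, rfl⟩ := hu
      obtain ⟨s, ⟨_, hs⟩, rfl⟩ := hv
      exact hmR s hs (hback r hr _ (hmA s hs) huv ▸ hr)
  · rw [Finset.card_union_of_disjoint, Finset.card_image_of_injOn,
      Finset.card_sdiff_add_card_inter, hcard]
    · intro r hr s hs hrs
      simp only [Finset.coe_inter, Set.mem_inter_iff, Finset.mem_coe] at hr hs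
      exact hback s hs.2 r (hRA hr.2) (hrs ▸ (hadj r hr.2).symm)
    · rw [Finset.disjoint_left]
      intro v hv hv'
      simp only [Finset.mem_sdiff, Finset.mem_image, Finset.mem_inter] at hv hv'
      obtain ⟨r, ⟨hrI, hr⟩, rfl⟩ := hv'
      exact hI r hrI _ hv.1 (hadj r hr)

/-- No vertex outside can have all its inside neighbors in an avoidable set. -/
theorem IsMaxAI.false_of_avoiding (h : IsMaxAI G α A) (R : Finset V) (hRA : R ⊆ A)
    (hR : ∀ r ∈ R, ∃ m ∈ A, G.Adj r m ∧ m ∉ R) {b : V} (hb : b ∉ A)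
    (hbR : ∀ u ∈ A, G.Adj b u → u ∈ R) : False := by
  obtain ⟨I, hIA, hI, hcard⟩ := h.exists_indep_avoiding R hRA hR
  have hbI : b ∉ I := fun hbI => hb (Finset.mem_sdiff.mp (hIA hbI)).1
  have hbadj : ∀ u ∈ I, ¬ G.Adj b u := fun u hu hbu =>
    (Finset.mem_sdiff.mp (hIA hu)).2 (hbR u (Finset.mem_sdiff.mp (hIA hu)).1 hbu)
  have := h.card_le (insert b I) (by
    intro u hu v hv huv
    rcases Finset.mem_insert.mp hu with rfl | hu' <;>
      rcases Finset.mem_insert.mp hv with rfl | hv'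
    · exact G.loopless.irrefl _ huv
    · exact hbadj v hv' huv
    · exact hbadj u hu' huv.symm
    · exact hI u hu' v hv' huv)
  rw [Finset.card_insert_of_notMem hbI, hcard] at this
  omega

/-- The complement of a MAI set is an AI set. -/
theorem IsMaxAI.outside (h : IsMaxAI G α A) (hG : ShortCycleFree G) {b c d : V} (hb : b ∉ A)
    (hc : c ∉ A) (hd : d ∉ A) (hbc : G.Adj b c) (hbd : G.Adj b d) : c = d := by
  by_contra hcd
  have huniq : ∀ u ∈ A, ∀ v ∈ A, G.Adj b u → G.Adj b v → u = v := by
    intro u hu v hv hbu hbv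
    by_contra huv
    exact hG.subcubic b c d u v hbc hbd hbu hbv hcd (fun e => hc (e ▸ hu)) (fun e => hc (e ▸ hv))
      (fun e => hd (e ▸ hu)) (fun e => hd (e ▸ hv)) huv
  by_cases hex : ∃ a ∈ A, G.Adj b a
  · obtain ⟨a, ha, hba⟩ := hex
    by_cases hm : ∃ m ∈ A, G.Adj a m
    · obtain ⟨m, hm, ham⟩ := hm
      refine h.false_of_avoiding {a} (by simpa using ha) ?_ hb ?_
      · intro r hr
        obtain rfl := Finset.mem_singleton.mp hr
        exact ⟨m, hm, ham, by simpa using ham.ne'⟩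
      · intro u hu hbu
        simpa using huniq u hu a ha hbu hba
    · have hb' : ∀ u ∈ A, G.Adj b u → u = a := fun u hu hbu => huniq u hu a ha hbu hba
      obtain ⟨I, hI, hI'⟩ := h.indep
      have := h.max (insert b A) ?_ ⟨I, hI.trans (Finset.subset_insert _ _), hI'⟩
      · rw [Finset.card_insert_of_notMem hb] at this
        omega
      · intro u hu v hv w hw huv huw
        have hirr : ∀ x, ¬ G.Adj x x := fun x => G.loopless.irrefl x
        push Not at hm
        rcases Finset.mem_insert.mp hu with rfl | hu'
        · rcases Finset.mem_insert.mp hv with rfl | hv'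
          · exact absurd huv (hirr _)
          rcases Finset.mem_insert.mp hw with rfl | hw'
          · exact absurd huw (hirr _)
          exact huniq v hv' w hw' huv huw
        · rcases Finset.mem_insert.mp hv with rfl | hv'
          · rcases Finset.mem_insert.mp hw with rfl | hw'
            · rfl
            · exact absurd huw (hb' u hu' huv.symm ▸ hm w hw')
          · rcases Finset.mem_insert.mp hw with rfl | hw'
            · exact absurd huv (hb' u hu' huw.symm ▸ hm v hv')
            · exact h.ai u hu' v hv' w hw' huv huw
  · push Not at hex
    exact h.false_of_avoiding ∅ (by simp) (by simp) hb fun u hu hbu => absurd hbu (hex u hu)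

/-- A vertex matched outside `A` has at most one neighbor matched inside `A`. -/
theorem IsMaxAI.outside_unique (h : IsMaxAI G α A) (hG : ShortCycleFree G) {b b' a c a' c' : V}
    (hb : b ∉ A) (hb' : b' ∉ A) (hbb' : G.Adj b b') (ha : a ∈ A) (hc : c ∈ A)
    (hba : G.Adj b a) (hbc : G.Adj b c) (ha' : a' ∈ A) (hc' : c' ∈ A) (haa' : G.Adj a a')
    (hcc' : G.Adj c c') : a = c := by
  by_contra hac
  refine h.false_of_avoiding {a, c} ?_ ?_ hb ?_
  · intro u hu
    rcases Finset.mem_insert.mp hu with rfl | hu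
    · exact ha
    · exact Finset.mem_singleton.mp hu ▸ hc
  · intro r hr
    rcases Finset.mem_insert.mp hr with rfl | hr
    · refine ⟨a', ha', haa', ?_⟩
      simp only [Finset.mem_insert, Finset.mem_singleton, not_or]
      exact ⟨haa'.ne', fun e => hG.tri b r c hba (e ▸ haa') hbc.symm⟩
    · obtain rfl := Finset.mem_singleton.mp hr
      refine ⟨c', hc', hcc', ?_⟩
      simp only [Finset.mem_insert, Finset.mem_singleton, not_or]
      exact ⟨fun e => hG.tri b r a hbc (e ▸ hcc') hba.symm, hcc'.ne'⟩
  · intro u hu hbu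
    simp only [Finset.mem_insert, Finset.mem_singleton]
    by_contra hne
    push Not at hne
    exact hG.subcubic b b' a c u hbb' hba hbc hbu (fun e => hb' (e ▸ ha)) (fun e => hb' (e ▸ hc))
      (fun e => hb' (e ▸ hu)) hac hne.1.symm hne.2.symm

/-- A vertex matched inside `A` has at most one neighbor matched outside `A`. -/
theorem IsMaxAI.inside_unique (h : IsMaxAI G α A) (hG : ShortCycleFree G) {a a' b c b' c' : V}
    (ha : a ∈ A) (ha' : a' ∈ A) (haa' : G.Adj a a') (hb : b ∉ A) (hc : c ∉ A)
    (hab : G.Adj a b) (hac : G.Adj a c) (hb' : b' ∉ A) (hc' : c' ∉ A) (hbb' : G.Adj b b')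
    (hcc' : G.Adj c c') : b = c := by
  by_contra hne
  obtain ⟨I, hIA, hI⟩ := h.exists_indep_avoiding {a} (by simpa using ha) (by
    intro r hr
    obtain rfl := Finset.mem_singleton.mp hr
    exact ⟨a', ha', haa', by simpa using haa'.ne'⟩)
  have hirr : ∀ x, ¬ G.Adj x x := fun x => G.loopless.irrefl x
  have hbc : ¬ G.Adj b c := fun e => hG.tri a b c hab e hac.symm
  -- inside neighbors other than `a` are unmatched, unique and not shared
  have hout : ∀ x x', x ∉ A → x' ∉ A → G.Adj a x → G.Adj x x' →
      (∀ u ∈ A, G.Adj x u → u ≠ a → ∀ v ∈ A, ¬ G.Adj u v) ∧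
      (∀ u ∈ A, ∀ v ∈ A, G.Adj x u → G.Adj x v → u ≠ a → v ≠ a → u = v) := by
    intro x x' hx hx' hax hxx'
    refine ⟨fun u hu hxu hua v hv huv => ?_, fun u hu v hv hxu hxv hua hva => ?_⟩
    · exact hua (h.outside_unique hG hx hx' hxx' hu ha hxu hax.symm hv ha' huv haa')
    · by_contra huv
      exact hG.subcubic x x' a u v hxx' hax.symm hxu hxv (fun e => hx' (e ▸ ha))
        (fun e => hx' (e ▸ hu)) (fun e => hx' (e ▸ hv)) hua.symm hva.symm huv
  obtain ⟨hb1, hb2⟩ := hout b b' hb hb' hab hbb'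
  obtain ⟨hc1, hc2⟩ := hout c c' hc hc' hac hcc'
  have hshare : ∀ u, G.Adj b u → G.Adj c u → u = a := by
    intro u hbu hcu
    by_contra hua
    exact hG.quad a b u c hab hbu hcu.symm hac.symm (Ne.symm hua) hne
  have := h.max (insert b (insert c (A.erase a))) ?_ ⟨I, ?_, hI⟩
  · rw [Finset.card_insert_of_notMem (by simp [hne, hb]),
      Finset.card_insert_of_notMem (by simp [hc]), Finset.card_erase_of_mem ha] at this
    have := Finset.card_pos.mpr ⟨a, ha⟩
    omega
  · simp only [Finset.mem_insert, Finset.mem_erase]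
    have hcb : ¬ G.Adj c b := fun e => hbc e.symm
    rintro u hu v hv w hw huv huw
    have huvs := huv.symm
    have huws := huw.symm
    have hai := h.ai u
    clear hout hI hIA
    rcases hu with rfl | rfl | ⟨hua, hu⟩ <;> rcases hv with rfl | rfl | ⟨hva, hv⟩ <;>
      rcases hw with rfl | rfl | ⟨hwa, hw⟩ <;> grind
  · intro u hu
    have := hIA hu
    simp only [Finset.mem_sdiff, Finset.mem_singleton] at this
    simp [this]

/-- Replacing a set `S ⊆ A` by a set of outside vertices, the image of `S` under `b`. -/
theorem IsMaxAI.swap (h : IsMaxAI G α A) (hG : ShortCycleFree G) (S : Finset V) (hS : S ⊆ A)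
    (m b b' : V → V)
    (hm : ∀ a ∈ S, m a ∈ A ∧ G.Adj a (m a) ∧ m a ∉ S)
    (hb : ∀ a ∈ S, b a ∉ A ∧ G.Adj a (b a))
    (hb' : ∀ a ∈ S, b' a ∉ A ∧ G.Adj (b a) (b' a))
    (hbS : ∀ a ∈ S, ∀ c ∈ S, ¬ G.Adj (b a) (b c))
    (hd : ∀ a ∈ S, ∀ c ∈ S, ∀ d ∈ A, G.Adj (b a) d → G.Adj (b c) d → a = c) :
    IsMaxAI G α ((A \ S) ∪ S.image b) ∧ ((A \ S) ∪ S.image b).card = A.card := by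
  have hcard : ((A \ S) ∪ S.image b).card = A.card := by
    rw [Finset.card_union_of_disjoint, Finset.card_image_of_injOn,
      Finset.card_sdiff_add_card_eq_card hS]
    · intro a ha c hc hac
      exact hd a ha c hc a (hS ha) (hb a ha).2.symm (hac ▸ (hb a ha).2.symm)
    · rw [Finset.disjoint_left]
      intro v hv hv'
      obtain ⟨a, ha, rfl⟩ := Finset.mem_image.mp hv'
      exact (hb a ha).1 (Finset.mem_sdiff.mp hv).1
  obtain ⟨I, hIA, hI⟩ := h.exists_indep_avoiding S hS fun r hr => ⟨m r, hm r hr⟩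
  refine ⟨⟨?_, ⟨I, hIA.trans Finset.subset_union_left, hI⟩, h.card_le,
    fun B hB hB' => hcard ▸ h.max B hB hB'⟩, hcard⟩
  have huniq : ∀ a ∈ S, ∀ u ∈ A, ∀ v ∈ A, u ∉ S → v ∉ S → G.Adj (b a) u → G.Adj (b a) v →
      u = v := by
    intro a ha u hu v hv huS hvS hau hav
    by_contra huv
    exact hG.subcubic (b a) (b' a) a u v (hb' a ha).2 (hb a ha).2.symm hau hav
      (fun e => (hb' a ha).1 (by rw [e]; exact hS ha)) (fun e => (hb' a ha).1 (by rw [e]; exact hu))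
      (fun e => (hb' a ha).1 (by rw [e]; exact hv)) (fun e => huS (e ▸ ha))
        (fun e => hvS (e ▸ ha)) huv
  have hunm : ∀ a ∈ S, ∀ u ∈ A, u ∉ S → G.Adj (b a) u → ∀ v ∈ A, ¬ G.Adj u v := by
    intro a ha u hu huS hau v hv huv
    have := h.outside_unique hG (hb a ha).1 (hb' a ha).1 (hb' a ha).2 hu (hS ha) hau
      (hb a ha).2.symm hv (hm a ha).1 huv (hm a ha).2.1
    exact huS (this ▸ ha)
  have hmem : ∀ v, v ∈ (A \ S) ∪ S.image b ↔ (v ∈ A ∧ v ∉ S) ∨ ∃ a ∈ S, b a = v := by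
    intro v
    simp
  intro u hu v hv w hw huv huw
  rw [hmem] at hu hv hw
  rcases hu with ⟨hu, huS⟩ | ⟨a, ha, rfl⟩ <;> rcases hv with ⟨hv, hvS⟩ | ⟨c, hc, rfl⟩ <;>
    rcases hw with ⟨hw, hwS⟩ | ⟨e, he, rfl⟩
  · exact h.ai u hu v hv w hw huv huw
  · exact absurd huv (hunm e he u hu huS huw.symm v hv)
  · exact absurd huw (hunm c hc u hu huS huv.symm w hw)
  · rw [hd c hc e he u hu huv.symm huw.symm]
  · exact huniq a ha v hv w hw hvS hwS huv huw
  · exact absurd huw (hbS a ha e he)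
  · exact absurd huv (hbS a ha c hc)
  · exact absurd huv (hbS a ha c hc)

end MaxAI

/-- The vertices of `A` that have a neighbor in `A` as well as a neighbor outside `A` which
itself has a neighbor outside `A`. -/
noncomputable def crossing {V : Type*} (G : SimpleGraph V) (A : Finset V) : Finset V :=
  open Classical in
  A.filter fun a => (∃ m ∈ A, G.Adj a m) ∧ ∃ b ∉ A, G.Adj a b ∧ ∃ b' ∉ A, G.Adj b b'

section MaxAI

variable {V : Type*} [DecidableEq V] {G : SimpleGraph V} {α : ℕ} {A : Finset V}

theorem IsMaxAI.no_common_neighbor (h : IsMaxAI G α A) (hG : ShortCycleFree G)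
    {a ma b b' c mc e e' d : V} (ha : a ∈ A) (hma : ma ∈ A) (hama : G.Adj a ma) (hb : b ∉ A)
    (hb' : b' ∉ A) (hab : G.Adj a b) (hbb' : G.Adj b b') (hc : c ∈ A) (hmc : mc ∈ A)
    (hcmc : G.Adj c mc) (he : e ∉ A) (he' : e' ∉ A) (hce : G.Adj c e) (hee' : G.Adj e e')
    (hd : d ∈ A) (hbd : G.Adj b d) (hed : G.Adj e d) : a = c := by
  by_contra hac
  have hda : d ≠ a := by
    rintro rfl
    exact hac (h.outside_unique hG he he' hee' hd hc hed hce.symm hma hmc hama hcmc)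
  have hdc : d ≠ c := by
    rintro rfl
    exact hac (h.outside_unique hG hb hb' hbb' ha hd hab.symm hbd hma hmc hama hcmc)
  have hbe : e ≠ b := by
    rintro rfl
    exact hac (h.outside_unique hG hb hb' hbb' ha hc hab.symm hce.symm hma hmc hama hcmc)
  obtain ⟨h', -⟩ := h.swap hG {a} (by simpa using ha) (fun _ => ma) (fun _ => b) (fun _ => b')
    (by simpa using ⟨hma, hama, hama.ne'⟩) (by simpa using ⟨hb, hab⟩) (by simpa using ⟨hb', hbb'⟩)
    (by simp) (by simp)
  have hmem : ∀ v, v ∈ (A \ {a}) ∪ ({a} : Finset V).image (fun _ => b) ↔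
      (v ∈ A ∧ v ≠ a) ∨ v = b := by
    intro v
    simp [or_comm]
  refine hdc (h'.outside_unique hG (b := e) (b' := e') ?_ ?_ hee' ?_ ?_ hed hce.symm
    (a' := b) (c' := mc) ?_ ?_ hbd.symm hcmc)
  · rw [hmem]; tauto
  · rw [hmem]
    rintro (h1 | rfl)
    · exact he' h1.1
    · exact hG.tri _ _ _ hbd hed.symm hee'
  · rw [hmem]; tauto
  · rw [hmem]; exact Or.inl ⟨hc, Ne.symm hac⟩
  · rw [hmem]; tauto
  · rw [hmem]
    refine Or.inl ⟨hmc, ?_⟩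
    rintro rfl
    exact hG.pent _ _ _ _ _ hab hbd hed.symm hce.symm hcmc

theorem IsMaxAI.goldenRatio_pow_le [Fintype V] (h : IsMaxAI G α A) (hG : ShortCycleFree G)
    [DecidablePred (IsMaxAI G α)] :
    Real.goldenRatio ^ (crossing G A).card ≤
      ((Finset.univ.filter fun B : Finset V => IsMaxAI G α B).card : ℝ) := by
  classical
  have hJ : ∀ a ∈ crossing G A, a ∈ A ∧ (∃ m, m ∈ A ∧ G.Adj a m) ∧
      ∃ b b', b ∉ A ∧ b' ∉ A ∧ G.Adj a b ∧ G.Adj b b' := by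
    intro a ha
    simp only [crossing, Finset.mem_filter] at ha
    obtain ⟨ha, ⟨m, hm⟩, b, hb, hab, b', hb', hbb'⟩ := ha
    exact ⟨ha, ⟨m, hm⟩, b, b', hb, hb', hab, hbb'⟩
  choose! hJA hm hb using hJ
  choose! m hmA ham using hm
  choose! b b' hbA hb'A hab hbb' using hb
  have hcom : ∀ a ∈ crossing G A, ∀ c ∈ crossing G A, ∀ d ∈ A, G.Adj (b a) d → G.Adj (b c) d →
      a = c := fun a ha c hc d hd had hcd =>
    h.no_common_neighbor hG (hJA a ha) (hmA a ha) (ham a ha) (hbA a ha) (hb'A a ha) (hab a ha)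
      (hbb' a ha) (hJA c hc) (hmA c hc) (ham c hc) (hbA c hc) (hb'A c hc) (hab c hc) (hbb' c hc)
      hd had hcd
  have hinj : ∀ a ∈ crossing G A, ∀ c ∈ crossing G A, b a = b c → a = c := fun a ha c hc hac =>
    hcom a ha c hc a (hJA a ha) (hab a ha).symm (hac ▸ (hab a ha).symm)
  refine (goldenRatio_pow_le_card_of_matchings (crossing G A) (fun u v => G.Adj u v)
    (fun u v => G.Adj (b u) (b v)) (fun _ _ e => e.symm) ?_ (fun _ _ e => e.symm) ?_).trans ?_
  · intro u hu v hv w hw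
    exact h.ai u (hJA u hu) v (hJA v hv) w (hJA w hw)
  · intro u hu v hv w hw huv huw
    exact hinj v hv w hw (h.outside hG (hbA u hu) (hbA v hv) (hbA w hw) huv huw)
  · rw [Nat.cast_le]
    refine Finset.card_le_card_of_injOn (fun S => (A \ S) ∪ S.image b) ?_ ?_
    · intro S hS
      simp only [Finset.coe_filter, Finset.mem_powerset, Set.mem_ofPred_eq] at hS
      obtain ⟨hSJ, hS⟩ := hS
      simp only [Finset.coe_filter, Finset.mem_univ, true_and, Set.mem_ofPred_eq]
      refine (h.swap hG S (fun a ha => hJA a (hSJ ha)) m b b' ?_ ?_ ?_ ?_ ?_).1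
      · intro a ha
        refine ⟨hmA a (hSJ ha), ham a (hSJ ha), fun hma => ?_⟩
        exact (hS a ha _ hma (ham a (hSJ ha)).ne).1 (ham a (hSJ ha))
      · exact fun a ha => ⟨hbA a (hSJ ha), hab a (hSJ ha)⟩
      · exact fun a ha => ⟨hb'A a (hSJ ha), hbb' a (hSJ ha)⟩
      · intro a ha c hc hac
        rcases eq_or_ne a c with rfl | hne
        · exact G.loopless.irrefl _ hac
        · exact (hS a ha c hc hne).2 hac
      · exact fun a ha c hc => hcom a (hSJ ha) c (hSJ hc)
    · have hrec : ∀ S ⊆ crossing G A, A \ ((A \ S) ∪ S.image b) = S := by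
        intro S hS
        ext v
        simp only [Finset.mem_sdiff, Finset.mem_union, Finset.mem_image, not_or, not_and, not_not,
          not_exists]
        constructor
        · exact fun hv => hv.2.1 hv.1
        · exact fun hv => ⟨hJA v (hS hv), fun _ => hv, fun a ha e =>
            hbA a (hS ha) (e ▸ hJA v (hS hv))⟩
      intro S hS T hT hST
      simp only [Finset.coe_filter, Finset.mem_powerset, Set.mem_ofPred_eq] at hS hT
      simp only at hST
      rw [← hrec S hS.1, ← hrec T hT.1, hST]

end MaxAI

section Size

variable {V : Type*} [DecidableEq V] {G : SimpleGraph V}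

/-- Halving a symmetric fixed-point-free matching: an independent set meets each matched pair at
most once. -/
theorem two_mul_card_indep_le {X I M : Finset V}
    (hM : ∀ v, v ∈ M ↔ v ∈ X ∧ ∃ u ∈ X, G.Adj v u)
    (hX : ∀ a ∈ X, ∀ b ∈ X, ∀ c ∈ X, G.Adj a b → G.Adj a c → b = c)
    (hI : ∀ u ∈ I, ∀ v ∈ I, ¬ G.Adj u v) (hIX : I ⊆ X) :
    2 * I.card + M.card ≤ 2 * X.card := by
  have hm : ∀ v ∈ M, ∃ u, u ∈ X ∧ G.Adj v u := fun v hv => ((hM v).mp hv).2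
  have hMX : ∀ v ∈ M, v ∈ X := fun v hv => ((hM v).mp hv).1
  choose! m hmX hm using hm
  have h1 : (M.filter (· ∈ I)).card ≤ (M.filter (· ∉ I)).card := by
    refine Finset.card_le_card_of_injOn m ?_ ?_
    · intro v hv
      simp only [Finset.coe_filter, Set.mem_ofPred_eq] at hv ⊢
      exact ⟨(hM _).mpr ⟨hmX v hv.1, v, hIX hv.2, (hm v hv.1).symm⟩,
        fun e => hI v hv.2 _ e (hm v hv.1)⟩
    · intro v hv w hw hvw
      simp only [Finset.coe_filter, Set.mem_ofPred_eq] at hv hw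
      exact hX (m v) (hmX v hv.1) v (hIX hv.2) w (hIX hw.2) (hm v hv.1).symm
        (hvw ▸ (hm w hw.1).symm)
  have h2 := M.card_filter_add_card_filter_not (· ∈ I)
  have h3 : I.card + (M.filter (· ∉ I)).card ≤ X.card := by
    rw [← Finset.card_union_of_disjoint]
    · refine Finset.card_le_card (Finset.union_subset hIX ?_)
      exact fun v hv => hMX v (Finset.filter_subset _ _ hv)
    · rw [Finset.disjoint_left]
      intro v hv hv'
      exact (Finset.mem_filter.mp hv').2 hv
  omega

/-- An almost independent set contains an independent set meeting every matched pair once. -/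
theorem exists_indep_two_mul_card {X M : Finset V}
    (hM : ∀ v, v ∈ M ↔ v ∈ X ∧ ∃ u ∈ X, G.Adj v u)
    (hX : ∀ a ∈ X, ∀ b ∈ X, ∀ c ∈ X, G.Adj a b → G.Adj a c → b = c) :
    ∃ I ⊆ X, (∀ u ∈ I, ∀ v ∈ I, ¬ G.Adj u v) ∧
      2 * I.card + M.card = 2 * X.card := by
  have hm : ∀ v ∈ M, ∃ u, u ∈ X ∧ G.Adj v u := fun v hv => ((hM v).mp hv).2
  have hMX : ∀ v ∈ M, v ∈ X := fun v hv => ((hM v).mp hv).1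
  choose! m hmX hm using hm
  have hmM : ∀ v ∈ M, m v ∈ M := fun v hv =>
    (hM _).mpr ⟨hmX v hv, v, hMX v hv, (hm v hv).symm⟩
  have hmm : ∀ v ∈ M, m (m v) = v := fun v hv =>
    hX (m v) (hmX v hv) _ (hmX _ (hmM v hv)) v (hMX v hv) (hm _ (hmM v hv)) (hm v hv).symm
  have := Classical.decRel (WellOrderingRel (α := V))
  let _ : LinearOrder V := linearOrderOfSTO WellOrderingRel
  have hne : ∀ v ∈ M, m v ≠ v := fun v hv e => G.loopless.irrefl v (by simpa [e] using hm v hv)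
  have h1 : (M.filter fun v => v < m v).card = (M.filter fun v => ¬ v < m v).card := by
    refine Finset.card_bij (fun v _ => m v) ?_ ?_ ?_
    · intro v hv
      simp only [Finset.mem_filter] at hv ⊢
      refine ⟨hmM v hv.1, ?_⟩
      rw [hmm v hv.1]
      exact hv.2.asymm
    · intro v hv w hw hvw
      simp only [Finset.mem_filter] at hv hw
      rw [← hmm v hv.1, ← hmm w hw.1, hvw]
    · intro v hv
      simp only [Finset.mem_filter] at hv
      refine ⟨m v, ?_, hmm v hv.1⟩
      simp only [Finset.mem_filter]
      refine ⟨hmM v hv.1, ?_⟩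
      rw [hmm v hv.1]
      exact lt_of_le_of_ne (not_lt.mp hv.2) (hne v hv.1)
  have h2 := M.card_filter_add_card_filter_not (fun v => v < m v)
  refine ⟨X \ M.filter fun v => v < m v, Finset.sdiff_subset, ?_, ?_⟩
  · intro u hu v hv huv
    simp only [Finset.mem_sdiff, Finset.mem_filter, not_and] at hu hv
    have huM : u ∈ M := (hM _).mpr ⟨hu.1, v, hv.1, huv⟩
    have hvM : v ∈ M := (hM _).mpr ⟨hv.1, u, hu.1, huv.symm⟩
    have e1 : m u = v := hX u hu.1 _ (hmX u huM) v hv.1 (hm u huM) huv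
    have e2 : m v = u := by rw [← e1, hmm u huM]
    have h1 := hu.2 huM
    have h2 := hv.2 hvM
    rw [e1] at h1
    rw [e2] at h2
    exact huv.ne (le_antisymm (not_lt.mp h2) (not_lt.mp h1))
  · have : (M.filter fun v => v < m v) ⊆ X :=
      fun v hv => hMX v (Finset.filter_subset _ _ hv)
    have := Finset.card_sdiff_add_card_eq_card this
    omega

end Size

section Counting

open Classical

/-- `f` takes the same value at all elements of `T`. -/
def IsConstOn {X Y : Type*} (T : Finset X) (f : X → Y) : Prop :=
  ∀ x ∈ T, ∀ y ∈ T, f x = f y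

theorem IsConstOn.mono {X Y : Type*} {S T : Finset X} {f : X → Y} (h : IsConstOn T f)
    (hST : S ⊆ T) : IsConstOn S f :=
  fun x hx y hy => h x (hST hx) y (hST hy)

theorem card_le_mul_of_image {X Y : Type*} [DecidableEq Y] {S : Finset X} (f : X → Y) {c d : ℕ}
    (hc : (S.image f).card ≤ c)
    (hd : ∀ T ⊆ S, IsConstOn T f → T.card ≤ d) : S.card ≤ c * d := by
  refine (Finset.card_le_mul_card_image (f := f) S d ?_).trans ?_
  · intro y _
    refine hd _ (Finset.filter_subset _ _) ?_
    intro a ha b hb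
    rw [(Finset.mem_filter.mp ha).2, (Finset.mem_filter.mp hb).2]
  · rw [mul_comm]
    exact Nat.mul_le_mul_right _ hc

/-- Functions that are injective from `D` to `R` and prescribed off `D`. -/
theorem card_le_descFactorial {X Y : Type*} (F : Finset (X → Y)) (D : Finset X) (R : Finset Y)
    (y₀ : X → Y) (hinj : ∀ f ∈ F, Set.InjOn f D) (hmaps : ∀ f ∈ F, ∀ x ∈ D, f x ∈ R)
    (hoff : ∀ f ∈ F, ∀ x ∉ D, f x = y₀ x) : F.card ≤ R.card.descFactorial D.card := by
  have : Fintype.card (D ↪ R) = R.card.descFactorial D.card := by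
    rw [Fintype.card_embedding_eq, Fintype.card_coe, Fintype.card_coe]
  rw [← this, ← Fintype.card_coe F]
  refine Fintype.card_le_of_injective
    (fun f => ⟨fun x => ⟨f.1 x, hmaps f.1 f.2 x x.2⟩, fun x y hxy =>
      Subtype.ext (hinj f.1 f.2 x.2 y.2 (by simpa using hxy))⟩) ?_
  intro f g hfg
  ext x
  by_cases hx : x ∈ D
  · have := congrArg (fun e : D ↪ R => ((e ⟨x, hx⟩ : R) : Y)) hfg
    exact this
  · rw [hoff f.1 f.2 x hx, hoff g.1 g.2 x hx]

/-- The point of `v` satisfying `Q`, if there is one. -/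
noncomputable def pointOf {V : Type*} (Q : V × Fin 3 → Prop) (v : V) : Fin 3 :=
  if h : ∃ j, Q (v, j) then h.choose else 0

/-- The vertex to which `v` is matched via its point satisfying `Q`. -/
noncomputable def partner {V : Type*} (σ : V × Fin 3 → V × Fin 3) (Q : V × Fin 3 → Prop) (v : V) :
    V :=
  if ∃ j, Q (v, j) then (σ (v, pointOf Q v)).1 else v

section Partner

variable {V : Type*} {σ : V × Fin 3 → V × Fin 3} {Q : V × Fin 3 → Prop}

/-- `Q` selects at most one point at every vertex and is invariant under `σ`. -/
structure IsSelector (σ : V × Fin 3 → V × Fin 3) (Q : V × Fin 3 → Prop) : Prop where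
  invol : ∀ p, σ (σ p) = p
  loopless : ∀ p, (σ p).1 ≠ p.1
  unique : ∀ v j k, Q (v, j) → Q (v, k) → j = k
  inv : ∀ p, Q p → Q (σ p)

theorem IsSelector.pointOf_eq (h : IsSelector σ Q) {p : V × Fin 3} (hp : Q p) :
    pointOf Q p.1 = p.2 := by
  have he : ∃ j, Q (p.1, j) := ⟨p.2, hp⟩
  rw [pointOf, dif_pos he]
  exact h.unique _ _ _ he.choose_spec hp

theorem IsSelector.apply (h : IsSelector σ Q) {p : V × Fin 3} (hp : Q p) :
    σ p = (partner σ Q p.1, pointOf Q (partner σ Q p.1)) := by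
  have he : ∃ j, Q (p.1, j) := ⟨p.2, hp⟩
  have : partner σ Q p.1 = (σ p).1 := by rw [partner, if_pos he, h.pointOf_eq hp]
  rw [this, h.pointOf_eq (h.inv p hp)]

theorem IsSelector.partner_ne_iff (h : IsSelector σ Q) (v : V) :
    partner σ Q v ≠ v ↔ ∃ j, Q (v, j) := by
  by_cases he : ∃ j, Q (v, j)
  · simp only [partner, he, if_true, iff_true]
    exact h.loopless (v, _)
  · simp [partner, he]

theorem IsSelector.iff (h : IsSelector σ Q) (p : V × Fin 3) :
    Q p ↔ partner σ Q p.1 ≠ p.1 ∧ pointOf Q p.1 = p.2 := by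
  rw [h.partner_ne_iff]
  refine ⟨fun hp => ⟨⟨p.2, hp⟩, h.pointOf_eq hp⟩, fun ⟨⟨j, hj⟩, hp⟩ => ?_⟩
  have := h.pointOf_eq hj
  simp only [hp] at this
  rwa [← this] at hj

theorem IsSelector.partner_eq (h : IsSelector σ Q) {p : V × Fin 3} (hp : Q p) :
    partner σ Q p.1 = (σ p).1 := by
  rw [h.apply hp]

theorem IsSelector.partner_partner (h : IsSelector σ Q) (v : V) :
    partner σ Q (partner σ Q v) = v := by
  by_cases he : ∃ j, Q (v, j)
  · obtain ⟨j, hj⟩ := he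
    have h1 := h.partner_eq hj
    rw [h1, h.partner_eq (h.inv _ hj), h.invol]
  · have : partner σ Q v = v := by simp [partner, he]
    rw [this, this]

theorem IsSelector.partner_injective (h : IsSelector σ Q) :
    Function.Injective (partner σ Q) :=
  Function.LeftInverse.injective h.partner_partner

/-- A selector and the matching on its points are determined by the partner map and the
selected points. -/
theorem IsSelector.congr {σ' : V × Fin 3 → V × Fin 3} {Q' : V × Fin 3 → Prop}
    (h : IsSelector σ Q) (h' : IsSelector σ' Q') (h1 : partner σ Q = partner σ' Q')
    (h2 : pointOf Q = pointOf Q') (p : V × Fin 3) : (Q p ↔ Q' p) ∧ (Q p → σ p = σ' p) := by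
  have hiff : Q p ↔ Q' p := by rw [h.iff, h'.iff, h1, h2]
  refine ⟨hiff, fun hp => ?_⟩
  rw [h.apply hp, h'.apply (hiff.mp hp), h1, h2]

theorem IsSelector.card_points [Fintype V] (h : IsSelector σ Q) (X : Finset V) :
    (Finset.univ.filter fun p : V × Fin 3 => p.1 ∈ X ∧ Q p).card =
      (X.filter fun v => ∃ j, Q (v, j)).card := by
  refine Finset.card_bij (fun p _ => p.1) ?_ ?_ ?_
  · intro p hp
    simp only [Finset.mem_filter, Finset.mem_univ, true_and] at hp ⊢
    exact ⟨hp.1, p.2, hp.2⟩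
  · intro p hp q hq hpq
    simp only [Finset.mem_filter, Finset.mem_univ, true_and] at hp hq
    refine Prod.ext hpq ?_
    rw [← h.pointOf_eq hp.2, ← h.pointOf_eq hq.2, hpq]
  · intro v hv
    simp only [Finset.mem_filter] at hv
    obtain ⟨hv, j, hj⟩ := hv
    exact ⟨(v, j), by simp [hv, hj], rfl⟩

end Partner

section Split

variable {V : Type*}

/-- A point whose pair does not cross between `A` and its complement. -/
def IsInner (A : Finset V) (σ : V × Fin 3 → V × Fin 3) (p : V × Fin 3) : Prop :=
  (σ p).1 ∈ A ↔ p.1 ∈ A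

/-- A point whose pair joins two vertices on different sides, both having inner points. -/
def IsCross (A : Finset V) (σ : V × Fin 3 → V × Fin 3) (p : V × Fin 3) : Prop :=
  ¬ IsInner A σ p ∧ (∃ j, IsInner A σ (p.1, j)) ∧ ∃ j, IsInner A σ ((σ p).1, j)

/-- The vertices of `X` with a point satisfying `Q`. -/
noncomputable def having (X : Finset V) (Q : V × Fin 3 → Prop) : Finset V :=
  X.filter fun v => ∃ j, Q (v, j)

theorem IsSelector.partner_cross_mem {A : Finset V} {σ : V × Fin 3 → V × Fin 3}
    (h : IsSelector σ (IsCross A σ)) {v : V}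
    (hv : ∃ j, IsCross A σ (v, j)) : (∃ j, IsCross A σ (partner σ (IsCross A σ) v, j)) ∧
      (partner σ (IsCross A σ) v ∈ A ↔ v ∉ A) := by
  obtain ⟨j, hj⟩ := hv
  rw [h.partner_eq hj]
  refine ⟨⟨_, h.inv _ hj⟩, ?_⟩
  have := hj.1
  simp only [IsInner] at this
  tauto

variable [Fintype V]

/-- A pairing for which `A` splits the vertices into two almost independent sets, with prescribed
numbers of matched vertices on both sides and of cross pairs. -/
structure IsSplit (A : Finset V) (t s j : ℕ) (σ : V × Fin 3 → V × Fin 3) : Prop where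
  inner : IsSelector σ (IsInner A σ)
  cross : IsSelector σ (IsCross A σ)
  card_in : (having A (IsInner A σ)).card = 2 * t
  card_out : (having Aᶜ (IsInner A σ)).card = 2 * s
  card_cross : (having A (IsCross A σ)).card = j

variable {A : Finset V} {t s j : ℕ} {σ : V × Fin 3 → V × Fin 3}

theorem IsSplit.card_cross_compl (h : IsSplit A t s j σ) :
    (having Aᶜ (IsCross A σ)).card = j := by
  rw [← h.card_cross]
  have key := fun v => h.cross.partner_cross_mem (v := v)
  refine Finset.card_bij (fun v _ => partner σ (IsCross A σ) v) ?_ ?_ ?_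
  · intro v hv
    simp only [having, Finset.mem_filter, Finset.mem_compl] at hv ⊢
    exact ⟨(key v hv.2).2.mpr hv.1, (key v hv.2).1⟩
  · exact fun v _ w _ hvw => h.cross.partner_injective hvw
  · intro v hv
    simp only [having, Finset.mem_filter] at hv
    refine ⟨partner σ (IsCross A σ) v, ?_, h.cross.partner_partner v⟩
    simp only [having, Finset.mem_filter, Finset.mem_compl]
    exact ⟨fun hm => (key v hv.2).2.mp hm hv.1, (key v hv.2).1⟩

/-- Involutions of a finite set with `t` transpositions. -/
theorem card_involutions (X : Type*) [Fintype X] [DecidableEq X] (t : ℕ)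
    (h : 2 * t ≤ Fintype.card X) :
    (Finset.univ.filter fun g : Equiv.Perm X => g.cycleType = Multiset.replicate t 2).card =
      (Fintype.card X).factorial /
        ((Fintype.card X - 2 * t).factorial * 2 ^ t * t.factorial) := by
  have := Equiv.Perm.card_of_cycleType X (Multiset.replicate t 2)
  rw [if_pos] at this
  · convert this using 2
    rcases Nat.eq_zero_or_pos t with rfl | ht
    · simp
    · rw [Multiset.toFinset_replicate, if_neg ht.ne']
      simp [mul_comm]
  · refine ⟨by simpa [mul_comm] using h, fun a ha => (Multiset.eq_of_mem_replicate ha).ge⟩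

theorem cycleType_eq_replicate {X : Type*} [Fintype X] [DecidableEq X] (g : Equiv.Perm X) (t : ℕ)
    (hg : ∀ x, g (g x) = x) (hc : (Finset.univ.filter fun x => g x ≠ x).card = 2 * t) :
    g.cycleType = Multiset.replicate t 2 := by
  have h2 : ∀ m ∈ g.cycleType, m = 2 := by
    intro m hm
    have h1 := Equiv.Perm.dvd_of_mem_cycleType hm
    have h3 := Equiv.Perm.two_le_of_mem_cycleType hm
    have h4 : orderOf g ∣ 2 := orderOf_dvd_of_pow_eq_one (by ext x; simp [pow_two, hg])
    exact le_antisymm (Nat.le_of_dvd two_pos (h1.trans h4)) h3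
  have h3 := Multiset.eq_replicate_card.mpr h2
  have h4 := g.sum_cycleType
  have h5 : g.support = Finset.univ.filter fun x => g x ≠ x := by ext; simp
  rw [h5, hc, h3, Multiset.sum_replicate, smul_eq_mul] at h4
  rw [h3]
  congr 1
  omega

end Split

end Counting

section Counting

open Classical

variable {V : Type*} {A : Finset V} {t s j : ℕ} {σ : V × Fin 3 → V × Fin 3}

theorem IsSelector.exists_perm {Q : V × Fin 3 → Prop} (h : IsSelector σ Q) (X : Finset V)
    (hX : ∀ p, Q p → ((σ p).1 ∈ X ↔ p.1 ∈ X)) {t : ℕ} (ht : (having X Q).card = 2 * t) :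
    ∃ g ∈ Finset.univ.filter fun g : Equiv.Perm X => g.cycleType = Multiset.replicate t 2,
      ∀ v : X, (g v : V) = partner σ Q v := by
  have hX' : ∀ v, partner σ Q v ∈ X ↔ v ∈ X := by
    intro v
    by_cases hv : ∃ j, Q (v, j)
    · obtain ⟨j, hj⟩ := hv
      rw [h.partner_eq hj, hX _ hj]
    · simp [partner, hv]
  let g : Equiv.Perm X := Function.Involutive.toPerm
    (fun v => ⟨partner σ Q v, (hX' v).mpr v.2⟩) fun v => Subtype.ext (h.partner_partner v)
  refine ⟨g, ?_, fun v => rfl⟩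
  rw [Finset.mem_filter]
  refine ⟨Finset.mem_univ _, cycleType_eq_replicate g t
    (fun v => Subtype.ext (h.partner_partner v)) ?_⟩
  rw [← ht]
  refine Finset.card_bij (fun v _ => (v : V)) ?_ (fun v _ w _ => Subtype.ext) ?_
  · intro v hv
    simp only [having, Finset.mem_filter, ← h.partner_ne_iff]
    exact ⟨v.2, fun e => (Finset.mem_filter.mp hv).2 (Subtype.ext e)⟩
  · intro v hv
    simp only [having, Finset.mem_filter, ← h.partner_ne_iff] at hv
    refine ⟨⟨v, hv.1⟩, ?_, rfl⟩
    rw [Finset.mem_filter]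
    exact ⟨Finset.mem_univ _, fun e => hv.2 (congrArg Subtype.val e)⟩

theorem having_subset (X : Finset V) (Q : V × Fin 3 → Prop) : having X Q ⊆ X :=
  Finset.filter_subset _ _

theorem having_card_le (X : Finset V) (Q : V × Fin 3 → Prop) : (having X Q).card ≤ X.card :=
  Finset.card_filter_le _ _

variable [Fintype V]

theorem card_image_inner_partner_le (T : Finset (V × Fin 3 → V × Fin 3))
    (hT : ∀ σ ∈ T, IsSplit A t s j σ) :
    (T.image fun σ => partner σ (IsInner A σ)).card ≤
      (A.card.factorial / ((A.card - 2 * t).factorial * 2 ^ t * t.factorial)) *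
      (Aᶜ.card.factorial / ((Aᶜ.card - 2 * s).factorial * 2 ^ s * s.factorial)) := by
  rcases T.eq_empty_or_nonempty with rfl | ⟨σ₀, hσ₀⟩
  · simp
  have h1 := card_involutions A t
    (by rw [Fintype.card_coe, ← (hT σ₀ hσ₀).card_in]; exact having_card_le _ _)
  have h2 := card_involutions (Aᶜ : Finset V) s
    (by rw [Fintype.card_coe, ← (hT σ₀ hσ₀).card_out]; exact having_card_le _ _)
  rw [Fintype.card_coe] at h1 h2
  rw [← h1, ← h2, ← Finset.card_product]
  refine (Finset.card_le_card ?_).trans (Finset.card_image_le (f :=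
    fun (g : Equiv.Perm A × Equiv.Perm (Aᶜ : Finset V)) (v : V) =>
      if h : v ∈ A then (g.1 ⟨v, h⟩ : V) else (g.2 ⟨v, Finset.mem_compl.mpr h⟩ : V)))
  intro f hf
  obtain ⟨σ, hσ, rfl⟩ := Finset.mem_image.mp hf
  have h := hT σ hσ
  obtain ⟨g₁, hg₁, hg₁'⟩ := h.inner.exists_perm A (fun p hp => hp) h.card_in
  obtain ⟨g₂, hg₂, hg₂'⟩ := h.inner.exists_perm Aᶜ
    (fun p hp => by simpa using not_congr hp) h.card_out
  refine Finset.mem_image.mpr ⟨(g₁, g₂), Finset.mem_product.mpr ⟨hg₁, hg₂⟩, ?_⟩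
  funext v
  by_cases hv : v ∈ A
  · simp only [hv, dif_pos]
    exact hg₁' ⟨v, hv⟩
  · simp only [hv, dif_neg, not_false_eq_true]
    exact hg₂' ⟨v, Finset.mem_compl.mpr hv⟩

theorem card_having_univ (A : Finset V) (Q : V × Fin 3 → Prop) :
    (having Finset.univ Q).card = (having A Q).card + (having Aᶜ Q).card := by
  rw [having, having, having, ← Finset.card_union_of_disjoint, ← Finset.filter_union,
    Finset.union_compl]
  exact Finset.disjoint_filter_filter disjoint_compl_right

/-- Choices of the selected points, given the set of vertices having one. -/
theorem card_image_pointOf_le {ι : Type*} (T : Finset ι) (Q : ι → V × Fin 3 → Prop)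
    (H : Finset V) (C : V → Finset (Fin 3)) (c : ℕ) (hC : ∀ v ∈ H, (C v).card = c)
    (hH : ∀ i ∈ T, having Finset.univ (Q i) = H) (hQ : ∀ i ∈ T, ∀ p, Q i p → p.2 ∈ C p.1) :
    (T.image fun i => pointOf (Q i)).card ≤ c ^ H.card := by
  have hcard : (Fintype.piFinset fun v => if v ∈ H then C v else {0}).card = c ^ H.card := by
    rw [Fintype.card_piFinset, ← Finset.prod_const, ← Finset.prod_subset H.subset_univ]
    · exact Finset.prod_congr rfl fun v hv => by rw [if_pos hv, hC v hv]
    · intro v _ hv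
      rw [if_neg hv, Finset.card_singleton]
  rw [← hcard]
  refine Finset.card_le_card fun f hf => ?_
  obtain ⟨i, hi, rfl⟩ := Finset.mem_image.mp hf
  rw [Fintype.mem_piFinset]
  intro v
  rw [← hH i hi]
  simp only [having, Finset.mem_filter, Finset.mem_univ, true_and, pointOf]
  by_cases h : ∃ j, Q i (v, j)
  · rw [if_pos h, dif_pos h]
    exact hQ i hi _ h.choose_spec
  · rw [if_neg h, dif_neg h]
    exact Finset.mem_singleton_self _


theorem IsSplit.having_inner_eq {σ' : V × Fin 3 → V × Fin 3} (h : IsSplit A t s j σ)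
    (h' : IsSplit A t s j σ') (h1 : partner σ (IsInner A σ) = partner σ' (IsInner A σ'))
    (X : Finset V) : having X (IsInner A σ) = having X (IsInner A σ') := by
  unfold having
  ext v
  rw [Finset.mem_filter, Finset.mem_filter, ← h.inner.partner_ne_iff, ← h'.inner.partner_ne_iff, h1]

theorem card_image_inner_point_le (T : Finset (V × Fin 3 → V × Fin 3))
    (hT : ∀ σ ∈ T, IsSplit A t s j σ) (h1 : IsConstOn T fun σ => partner σ (IsInner A σ)) :
    (T.image fun σ => pointOf (IsInner A σ)).card ≤ 3 ^ (2 * t + 2 * s) := by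
  rcases T.eq_empty_or_nonempty with rfl | ⟨σ₀, hσ₀⟩
  · simp
  have h := hT σ₀ hσ₀
  rw [← h.card_in, ← h.card_out, ← card_having_univ]
  exact card_image_pointOf_le T _ _ (fun _ => Finset.univ) 3 (by simp)
    (fun σ hσ => (hT σ hσ).having_inner_eq h (h1 σ hσ σ₀ hσ₀) _) (by simp)

theorem card_image_cross_le (T : Finset (V × Fin 3 → V × Fin 3))
    (hT : ∀ σ ∈ T, IsSplit A t s j σ) (h1 : IsConstOn T fun σ => partner σ (IsInner A σ)) :
    (T.image fun σ => (having A (IsCross A σ), having Aᶜ (IsCross A σ))).card ≤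
      (2 * t).choose j * (2 * s).choose j := by
  rcases T.eq_empty_or_nonempty with rfl | ⟨σ₀, hσ₀⟩
  · simp
  have h := hT σ₀ hσ₀
  rw [← h.card_in, ← h.card_out, ← Finset.card_powersetCard, ← Finset.card_powersetCard,
    ← Finset.card_product]
  refine Finset.card_le_card fun f hf => ?_
  obtain ⟨σ, hσ, rfl⟩ := Finset.mem_image.mp hf
  have hsub : ∀ X, having X (IsCross A σ) ⊆ having X (IsInner A σ₀) := by
    intro X
    rw [← (hT σ hσ).having_inner_eq h (h1 σ hσ σ₀ hσ₀)]
    intro v hv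
    simp only [having, Finset.mem_filter] at hv ⊢
    obtain ⟨hv, i, hi⟩ := hv
    exact ⟨hv, hi.2.1⟩
  rw [Finset.mem_product, Finset.mem_powersetCard, Finset.mem_powersetCard]
  exact ⟨⟨hsub A, (hT σ hσ).card_cross⟩, hsub Aᶜ, (hT σ hσ).card_cross_compl⟩

/-- The partner map on `A` only. -/
noncomputable def crossPartner (A : Finset V) (σ : V × Fin 3 → V × Fin 3) (v : V) : V :=
  if v ∈ A then partner σ (IsCross A σ) v else v

theorem card_image_crossPartner_le (T : Finset (V × Fin 3 → V × Fin 3))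
    (hT : ∀ σ ∈ T, IsSplit A t s j σ)
    (h1 : IsConstOn T fun σ => (having A (IsCross A σ), having Aᶜ (IsCross A σ))) :
    (T.image (crossPartner A)).card ≤ j.factorial := by
  rcases T.eq_empty_or_nonempty with rfl | ⟨σ₀, hσ₀⟩
  · simp
  have h := hT σ₀ hσ₀
  refine (card_le_descFactorial _ (having A (IsCross A σ₀)) (having Aᶜ (IsCross A σ₀)) id
    ?_ ?_ ?_).trans ?_
  · intro f hf
    obtain ⟨σ, hσ, rfl⟩ := Finset.mem_image.mp hf
    intro v hv w hw hvw
    simp only [having, Finset.coe_filter, Set.mem_ofPred_eq] at hv hw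
    simp only [crossPartner, hv.1, hw.1, if_true] at hvw
    exact (hT σ hσ).cross.partner_injective hvw
  · intro f hf
    obtain ⟨σ, hσ, rfl⟩ := Finset.mem_image.mp hf
    have := h1 σ hσ σ₀ hσ₀
    simp only [Prod.mk.injEq] at this
    rw [← this.1, ← this.2]
    intro v hv
    simp only [having, Finset.mem_filter, Finset.mem_compl] at hv ⊢
    have := (hT σ hσ).cross.partner_cross_mem hv.2
    simp only [crossPartner, hv.1, if_true]
    exact ⟨fun e => this.2.mp e hv.1, this.1⟩
  · intro f hf v hv
    obtain ⟨σ, hσ, rfl⟩ := Finset.mem_image.mp hf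
    have := h1 σ hσ σ₀ hσ₀
    simp only [Prod.mk.injEq] at this
    rw [← this.1] at hv
    simp only [crossPartner, id]
    split_ifs with hvA
    · by_contra hne
      exact hv (by simpa [having, hvA] using ((hT σ hσ).cross.partner_ne_iff v).mp hne)
    · rfl
  · rw [h.card_cross, h.card_cross_compl, Nat.descFactorial_self]

theorem partner_cross_const {T : Finset (V × Fin 3 → V × Fin 3)}
    (hT : ∀ σ ∈ T, IsSplit A t s j σ)
    (h1 : IsConstOn T fun σ => (having A (IsCross A σ), having Aᶜ (IsCross A σ)))
    (h2 : IsConstOn T (crossPartner A)) : IsConstOn T fun σ => partner σ (IsCross A σ) := by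
  intro σ hσ σ' hσ'
  have hA : ∀ v ∈ A, partner σ (IsCross A σ) v = partner σ' (IsCross A σ') v := by
    intro v hv
    have := congrFun (h2 σ hσ σ' hσ') v
    simpa [crossPartner, hv] using this
  have h := (hT σ hσ).cross
  have h' := (hT σ' hσ').cross
  funext v
  by_cases hv : v ∈ A
  · exact hA v hv
  have hc := congrArg Prod.snd (h1 σ hσ σ' hσ')
  have hiff : (∃ j, IsCross A σ (v, j)) ↔ ∃ j, IsCross A σ' (v, j) := by
    have := Finset.ext_iff.mp hc v
    simpa [having, hv] using this
  by_cases he : ∃ j, IsCross A σ (v, j)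
  · have hm := (h.partner_cross_mem he).2.mpr hv
    apply h'.partner_injective
    rw [h'.partner_partner, ← hA _ hm, h.partner_partner]
  · have he' := fun e => he (hiff.mpr e)
    dsimp only
    rw [partner, if_neg he, partner, if_neg he']

theorem card_image_cross_point_le (T : Finset (V × Fin 3 → V × Fin 3))
    (hT : ∀ σ ∈ T, IsSplit A t s j σ) (h0 : IsConstOn T fun σ => pointOf (IsInner A σ))
    (h1 : IsConstOn T fun σ => (having A (IsCross A σ), having Aᶜ (IsCross A σ))) :
    (T.image fun σ => pointOf (IsCross A σ)).card ≤ 2 ^ (2 * j) := by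
  rcases T.eq_empty_or_nonempty with rfl | ⟨σ₀, hσ₀⟩
  · simp
  have h := hT σ₀ hσ₀
  have hc : (having Finset.univ (IsCross A σ₀)).card = 2 * j := by
    rw [card_having_univ A, h.card_cross, h.card_cross_compl]
    ring
  rw [← hc]
  refine card_image_pointOf_le T _ _ (fun v => {pointOf (IsInner A σ₀) v}ᶜ) 2 ?_ ?_ ?_
  · intro v _
    rw [Finset.card_compl]
    simp
  · intro σ hσ
    have := h1 σ hσ σ₀ hσ₀
    simp only [Prod.mk.injEq] at this
    ext v
    have e1 := Finset.ext_iff.mp this.1 v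
    have e2 := Finset.ext_iff.mp this.2 v
    simp only [having, Finset.mem_filter, Finset.mem_compl, Finset.mem_univ, true_and] at e1 e2 ⊢
    tauto
  · intro σ hσ p hp
    simp only [Finset.mem_compl, Finset.mem_singleton]
    intro e
    have e2 : pointOf (IsInner A σ) = pointOf (IsInner A σ₀) := h0 σ hσ σ₀ hσ₀
    rw [← e2] at e
    refine hp.1 (((hT σ hσ).inner.iff p).mpr ⟨?_, e.symm⟩)
    exact ((hT σ hσ).inner.partner_ne_iff _).mpr hp.2.1

end Counting

section Counting

open Classical

variable {V : Type*} {A : Finset V} {t s j : ℕ} {σ : V × Fin 3 → V × Fin 3}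

/-- The points on the `A`-side of pairs from vertices with an inner point to vertices without. -/
def IsMixed (A : Finset V) (σ : V × Fin 3 → V × Fin 3) (p : V × Fin 3) : Prop :=
  p.1 ∈ A ∧ (∃ j, IsInner A σ (p.1, j)) ∧ ¬ IsInner A σ p ∧ ¬ IsCross A σ p

/-- The points of the vertices of `A` without inner point. -/
def IsSingle (A : Finset V) (σ : V × Fin 3 → V × Fin 3) (p : V × Fin 3) : Prop :=
  p.1 ∈ A ∧ ¬ ∃ j, IsInner A σ (p.1, j)

/-- Agreement on the inner and cross pairs. -/
structure Agree (A : Finset V) (T : Finset (V × Fin 3 → V × Fin 3)) : Prop where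
  inner_iff : ∀ σ ∈ T, ∀ σ' ∈ T, ∀ p, IsInner A σ p ↔ IsInner A σ' p
  cross_iff : ∀ σ ∈ T, ∀ σ' ∈ T, ∀ p, IsCross A σ p ↔ IsCross A σ' p
  eq_inner : ∀ σ ∈ T, ∀ σ' ∈ T, ∀ p, IsInner A σ p → σ p = σ' p
  eq_cross : ∀ σ ∈ T, ∀ σ' ∈ T, ∀ p, IsCross A σ p → σ p = σ' p

theorem Agree.mono {S T : Finset (V × Fin 3 → V × Fin 3)} (h : Agree A T) (hS : S ⊆ T) :
    Agree A S where
  inner_iff σ hσ σ' hσ' := h.inner_iff σ (hS hσ) σ' (hS hσ')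
  cross_iff σ hσ σ' hσ' := h.cross_iff σ (hS hσ) σ' (hS hσ')
  eq_inner σ hσ σ' hσ' := h.eq_inner σ (hS hσ) σ' (hS hσ')
  eq_cross σ hσ σ' hσ' := h.eq_cross σ (hS hσ) σ' (hS hσ')

theorem Agree.mixed_iff {T : Finset (V × Fin 3 → V × Fin 3)} (h : Agree A T)
    {σ' : V × Fin 3 → V × Fin 3}
    (hσ : σ ∈ T) (hσ' : σ' ∈ T) (p : V × Fin 3) : IsMixed A σ p ↔ IsMixed A σ' p := by
  simp only [IsMixed, h.inner_iff σ hσ σ' hσ', h.cross_iff σ hσ σ' hσ']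

theorem Agree.single_iff {T : Finset (V × Fin 3 → V × Fin 3)} (h : Agree A T)
    {σ' : V × Fin 3 → V × Fin 3}
    (hσ : σ ∈ T) (hσ' : σ' ∈ T) (p : V × Fin 3) : IsSingle A σ p ↔ IsSingle A σ' p := by
  simp only [IsSingle, h.inner_iff σ hσ σ' hσ']

variable [Fintype V]

/-- The pairing restricted to mixed points. -/
noncomputable def mixedPart (A : Finset V) (σ : V × Fin 3 → V × Fin 3) (p : V × Fin 3) :
    V × Fin 3 :=
  if IsMixed A σ p then σ p else p

/-- The pairing restricted to points of single vertices. -/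
noncomputable def singlePart (A : Finset V) (σ : V × Fin 3 → V × Fin 3) (p : V × Fin 3) :
    V × Fin 3 :=
  if IsSingle A σ p then σ p else p

theorem card_filter_fst_mem (X : Finset V) :
    (Finset.univ.filter fun p : V × Fin 3 => p.1 ∈ X).card = 3 * X.card := by
  have : (Finset.univ.filter fun p : V × Fin 3 => p.1 ∈ X) = X ×ˢ Finset.univ := by
    ext p
    simp
  rw [this, Finset.card_product, Finset.card_univ, Fintype.card_fin, mul_comm]

theorem IsSplit.card_mixed (h : IsSplit A t s j σ) :
    (Finset.univ.filter (IsMixed A σ)).card = 4 * t - j := by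
  have h1 := h.inner.card_points A
  have h2 := h.cross.card_points A
  have h3 := card_filter_fst_mem (having A (IsInner A σ))
  have e1 := h.card_in
  have e2 := h.card_cross
  unfold having at e1 e2
  rw [e1] at h1
  rw [e2] at h2
  rw [h.card_in] at h3
  have hu : (Finset.univ.filter fun p : V × Fin 3 => p.1 ∈ having A (IsInner A σ)) =
      ((Finset.univ.filter fun p : V × Fin 3 => p.1 ∈ A ∧ IsInner A σ p) ∪
      (Finset.univ.filter fun p : V × Fin 3 => p.1 ∈ A ∧ IsCross A σ p)) ∪
      Finset.univ.filter (IsMixed A σ) := by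
    ext p
    simp only [having, Finset.mem_filter, Finset.mem_univ, true_and, Finset.mem_union, IsMixed]
    have a1 : IsInner A σ p → ∃ j, IsInner A σ (p.1, j) := fun hp => ⟨p.2, hp⟩
    have a2 : IsCross A σ p → ∃ j, IsInner A σ (p.1, j) := fun hp => hp.2.1
    tauto
  rw [hu, Finset.card_union_of_disjoint, Finset.card_union_of_disjoint, h1, h2] at h3
  · omega
  · rw [Finset.disjoint_filter]
    exact fun p _ hp hp' => hp'.2.1 hp.2
  · rw [Finset.disjoint_union_left, Finset.disjoint_filter, Finset.disjoint_filter]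
    exact ⟨fun p _ hp hp' => hp'.2.2.1 hp.2, fun p _ hp hp' => hp'.2.2.2 hp.2⟩

theorem IsSplit.card_single (h : IsSplit A t s j σ) :
    (Finset.univ.filter (IsSingle A σ)).card = 3 * (A.card - 2 * t) := by
  have : Finset.univ.filter (IsSingle A σ) =
      Finset.univ.filter fun p : V × Fin 3 => p.1 ∈ A \ having A (IsInner A σ) := by
    ext p
    simp only [IsSingle, having, Finset.mem_filter, Finset.mem_univ, true_and, Finset.mem_sdiff]
    tauto
  rw [this, card_filter_fst_mem, Finset.card_sdiff_of_subset (having_subset _ _),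
    h.card_in]

theorem agree_of_const {T : Finset (V × Fin 3 → V × Fin 3)} (hT : ∀ σ ∈ T, IsSplit A t s j σ)
    (h1 : IsConstOn T fun σ => partner σ (IsInner A σ))
    (h2 : IsConstOn T fun σ => pointOf (IsInner A σ))
    (h3 : IsConstOn T fun σ => partner σ (IsCross A σ))
    (h4 : IsConstOn T fun σ => pointOf (IsCross A σ)) : Agree A T := by
  have ki := fun σ (hσ : σ ∈ T) σ' (hσ' : σ' ∈ T) =>
    (hT σ hσ).inner.congr (hT σ' hσ').inner (h1 σ hσ σ' hσ') (h2 σ hσ σ' hσ')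
  have kc := fun σ (hσ : σ ∈ T) σ' (hσ' : σ' ∈ T) =>
    (hT σ hσ).cross.congr (hT σ' hσ').cross (h3 σ hσ σ' hσ') (h4 σ hσ σ' hσ')
  exact ⟨fun σ hσ σ' hσ' p => (ki σ hσ σ' hσ' p).1, fun σ hσ σ' hσ' p => (kc σ hσ σ' hσ' p).1,
    fun σ hσ σ' hσ' p => (ki σ hσ σ' hσ' p).2, fun σ hσ σ' hσ' p => (kc σ hσ σ' hσ' p).2⟩

theorem card_image_mixedPart_le (T : Finset (V × Fin 3 → V × Fin 3))
    (hT : ∀ σ ∈ T, IsSplit A t s j σ) (h1 : Agree A T) :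
    (T.image (mixedPart A)).card ≤ (3 * (Aᶜ.card - 2 * s)).descFactorial (4 * t - j) := by
  rcases T.eq_empty_or_nonempty with rfl | ⟨σ₀, hσ₀⟩
  · simp
  have h := hT σ₀ hσ₀
  refine (card_le_descFactorial _ (Finset.univ.filter (IsMixed A σ₀))
    (Finset.univ.filter fun p : V × Fin 3 => p.1 ∈ Aᶜ \ having Aᶜ (IsInner A σ₀)) id
    ?_ ?_ ?_).trans ?_
  · intro f hf
    obtain ⟨σ, hσ, rfl⟩ := Finset.mem_image.mp hf
    intro v hv w hw hvw
    simp only [Finset.coe_filter, Set.mem_ofPred_eq, Finset.mem_univ, true_and,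
      ← h1.mixed_iff hσ hσ₀] at hv hw
    simp only [mixedPart, hv, hw, if_true] at hvw
    exact Function.LeftInverse.injective (hT σ hσ).inner.invol hvw
  · intro f hf
    obtain ⟨σ, hσ, rfl⟩ := Finset.mem_image.mp hf
    intro p hp
    simp only [Finset.mem_filter, Finset.mem_univ, true_and, ← h1.mixed_iff hσ hσ₀] at hp
    simp only [mixedPart, hp, if_true, Finset.mem_filter, Finset.mem_univ, true_and, having,
      Finset.mem_sdiff, Finset.mem_compl, ← h1.inner_iff σ hσ σ₀ hσ₀]
    obtain ⟨hpA, hpm, hpi, hpc⟩ := hp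
    refine ⟨fun e => hpi (by simp [IsInner, e, hpA]), fun e => hpc ⟨hpi, hpm, e.2⟩⟩
  · intro f hf p hp
    obtain ⟨σ, hσ, rfl⟩ := Finset.mem_image.mp hf
    simp only [Finset.mem_filter, Finset.mem_univ, true_and, ← h1.mixed_iff hσ hσ₀] at hp
    simp [mixedPart, hp]
  · rw [h.card_mixed, card_filter_fst_mem,
      Finset.card_sdiff_of_subset (having_subset _ _), h.card_out]

theorem card_image_singlePart_le (T : Finset (V × Fin 3 → V × Fin 3))
    (hT : ∀ σ ∈ T, IsSplit A t s j σ) (h1 : Agree A T) (h2 : IsConstOn T (mixedPart A)) :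
    (T.image (singlePart A)).card ≤ (3 * (A.card - 2 * t)).factorial := by
  rcases T.eq_empty_or_nonempty with rfl | ⟨σ₀, hσ₀⟩
  · simp
  have h := hT σ₀ hσ₀
  have hinj : ∀ σ ∈ T, Function.Injective σ := fun σ hσ =>
    Function.LeftInverse.injective (hT σ hσ).inner.invol
  refine (card_le_descFactorial _ (Finset.univ.filter (IsSingle A σ₀))
    ((Finset.univ.filter (IsSingle A σ₀)).image σ₀) id ?_ ?_ ?_).trans ?_
  · intro f hf
    obtain ⟨σ, hσ, rfl⟩ := Finset.mem_image.mp hf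
    intro v hv w hw hvw
    simp only [Finset.coe_filter, Set.mem_ofPred_eq, Finset.mem_univ, true_and,
      ← h1.single_iff hσ hσ₀] at hv hw
    simp only [singlePart, hv, hw, if_true] at hvw
    exact hinj σ hσ hvw
  · intro f hf
    obtain ⟨σ, hσ, rfl⟩ := Finset.mem_image.mp hf
    intro p hp
    simp only [Finset.mem_filter, Finset.mem_univ, true_and, ← h1.single_iff hσ hσ₀] at hp
    simp only [singlePart, hp, if_true]
    refine Finset.mem_image.mpr ⟨σ₀ (σ p), ?_, h.inner.invol _⟩
    rw [Finset.mem_filter]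
    refine ⟨Finset.mem_univ _, ?_⟩
    have hpi : ¬ IsInner A σ p := fun e => hp.2 ⟨p.2, e⟩
    have hqA : (σ p).1 ∉ A := fun e => hpi (by simp [IsInner, e, hp.1])
    have hqi : ¬ IsInner A σ₀ (σ p) := by
      rw [← h1.inner_iff σ hσ σ₀ hσ₀]
      intro e
      have := (hT σ hσ).inner.inv _ e
      rw [(hT σ hσ).inner.invol] at this
      exact hpi this
    have hrA : (σ₀ (σ p)).1 ∈ A := by
      simp only [IsInner] at hqi
      tauto
    refine ⟨hrA, fun hm => ?_⟩
    have hri : ¬ IsInner A σ₀ (σ₀ (σ p)) := fun e => hqi (by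
      have := h.inner.inv _ e
      rwa [h.inner.invol] at this)
    have heq : σ (σ₀ (σ p)) = σ₀ (σ₀ (σ p)) := by
      by_cases hc : IsCross A σ₀ (σ₀ (σ p))
      · exact (h1.eq_cross σ₀ hσ₀ σ hσ _ hc).symm
      · have hmx : IsMixed A σ₀ (σ₀ (σ p)) := ⟨hrA, hm, hri, hc⟩
        have := congrFun (h2 σ hσ σ₀ hσ₀) (σ₀ (σ p))
        rwa [mixedPart, mixedPart, if_pos hmx, if_pos ((h1.mixed_iff hσ hσ₀ _).mpr hmx)] at this
    rw [h.inner.invol] at heq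
    have := hinj σ hσ heq
    rw [this] at hm
    obtain ⟨k, hk⟩ := hm
    exact hp.2 ⟨k, (h1.inner_iff σ hσ σ₀ hσ₀ _).mpr hk⟩
  · intro f hf p hp
    obtain ⟨σ, hσ, rfl⟩ := Finset.mem_image.mp hf
    simp only [Finset.mem_filter, Finset.mem_univ, true_and, ← h1.single_iff hσ hσ₀] at hp
    simp [singlePart, hp]
  · rw [Finset.card_image_of_injective _ (hinj σ₀ hσ₀), h.card_single, Nat.descFactorial_self]

theorem card_le_one_of_parts (T : Finset (V × Fin 3 → V × Fin 3))
    (hT : ∀ σ ∈ T, IsSplit A t s j σ) (h1 : Agree A T) (h2 : IsConstOn T (mixedPart A))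
    (h3 : IsConstOn T (singlePart A)) : T.card ≤ 1 := by
  rw [Finset.card_le_one]
  intro σ hσ σ' hσ'
  have key : ∀ p, p.1 ∈ A → σ p = σ' p := by
    intro p hp
    by_cases hi : IsInner A σ p
    · exact h1.eq_inner σ hσ σ' hσ' p hi
    by_cases hm : ∃ k, IsInner A σ (p.1, k)
    · by_cases hc : IsCross A σ p
      · exact h1.eq_cross σ hσ σ' hσ' p hc
      · have hmx : IsMixed A σ p := ⟨hp, hm, hi, hc⟩
        have := congrFun (h2 σ hσ σ' hσ') p
        rwa [mixedPart, mixedPart, if_pos hmx, if_pos ((h1.mixed_iff hσ hσ' _).mp hmx)] at this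
    · have hs : IsSingle A σ p := ⟨hp, hm⟩
      have := congrFun (h3 σ hσ σ' hσ') p
      rwa [singlePart, singlePart, if_pos hs, if_pos ((h1.single_iff hσ hσ' _).mp hs)] at this
  funext p
  by_cases hi : IsInner A σ p
  · exact h1.eq_inner σ hσ σ' hσ' p hi
  by_cases hp : p.1 ∈ A
  · exact key p hp
  have hq : (σ p).1 ∈ A := by
    simp only [IsInner] at hi
    tauto
  have := key _ hq
  rw [(hT σ hσ).inner.invol] at this
  conv_rhs => rw [this]
  rw [(hT σ' hσ').inner.invol]

/-- The number of pairings split by `A` in a prescribed way. -/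
theorem card_isSplit_le (S : Finset (V × Fin 3 → V × Fin 3))
    (hS : ∀ σ ∈ S, IsSplit A t s j σ) :
    S.card ≤ (A.card.factorial / ((A.card - 2 * t).factorial * 2 ^ t * t.factorial)) *
      ((Fintype.card V - A.card).factorial /
        ((Fintype.card V - A.card - 2 * s).factorial * 2 ^ s * s.factorial)) *
      (3 ^ (2 * t + 2 * s) * ((2 * t).choose j * (2 * s).choose j * (j.factorial *
      (2 ^ (2 * j) * ((3 * (Fintype.card V - A.card - 2 * s)).descFactorial (4 * t - j) *
      ((3 * (A.card - 2 * t)).factorial * 1)))))) := by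
  rw [← Finset.card_compl]
  refine card_le_mul_of_image _ (card_image_inner_partner_le S hS) fun T hTS h1 => ?_
  replace hS := fun σ hσ => hS σ (hTS hσ)
  refine card_le_mul_of_image _ (card_image_inner_point_le T hS h1) fun U hU h2 => ?_
  replace hS := fun σ hσ => hS σ (hU hσ)
  replace h1 := h1.mono hU
  refine card_le_mul_of_image _ (card_image_cross_le U hS h1) fun T hT h3 => ?_
  replace hS := fun σ hσ => hS σ (hT hσ)
  replace h1 := h1.mono hT
  replace h2 := h2.mono hT
  refine card_le_mul_of_image _ (card_image_crossPartner_le T hS h3) fun U hU h4 => ?_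
  replace hS := fun σ hσ => hS σ (hU hσ)
  replace h1 := h1.mono hU
  replace h2 := h2.mono hU
  replace h3 := h3.mono hU
  refine card_le_mul_of_image _ (card_image_cross_point_le U hS h2 h3) fun T hT h5 => ?_
  replace hS := fun σ hσ => hS σ (hT hσ)
  have hagree : Agree A T := agree_of_const hS (h1.mono hT) (h2.mono hT)
    (partner_cross_const hS (h3.mono hT) (h4.mono hT)) h5
  refine card_le_mul_of_image _ (card_image_mixedPart_le T hS hagree) fun U hU h6 => ?_
  replace hS := fun σ hσ => hS σ (hU hσ)
  replace hagree := hagree.mono hU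
  refine card_le_mul_of_image _ (card_image_singlePart_le U hS hagree h6) fun T hT h7 => ?_
  exact card_le_one_of_parts T (fun σ hσ => hS σ (hT hσ)) (hagree.mono hT) (h6.mono hT) h7

end Counting

section Graph

variable {n : ℕ} {σ : Fin n × Fin 3 → Fin n × Fin 3}

theorem projGraph_adj (h : IsPairing σ) (hs : ProjIsSimple σ) (u v : Fin n) :
    (projGraph σ).Adj u v ↔ ∃ j, (σ (u, j)).1 = v := by
  rw [projGraph, SimpleGraph.fromRel_adj]
  constructor
  · rintro ⟨-, ⟨j, k, e⟩ | ⟨j, k, e⟩⟩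
    · exact ⟨j, by rw [e]⟩
    · exact ⟨k, by rw [← e, h.1]⟩
  · rintro ⟨j, rfl⟩
    exact ⟨(hs.1 (u, j)).symm, Or.inl ⟨j, (σ (u, j)).2, rfl⟩⟩

theorem projGraph_shortCycleFree (h : MemGSixteen σ) : ShortCycleFree (projGraph σ) := by
  obtain ⟨hp, hs, hg⟩ := h
  have hcyc : ∀ a (w : (projGraph σ).Walk a a), w.IsCycle → 16 ≤ w.length := by
    intro a w hw
    have := SimpleGraph.le_egirth.mp hg a w hw
    exact_mod_cast this
  have tri : ∀ a b c, (projGraph σ).Adj a b → (projGraph σ).Adj b c → (projGraph σ).Adj c a →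
      False := by
    intro a b c hab hbc hca
    have := hcyc a (.cons hab (.cons hbc (.cons hca .nil))) (by
      simp [SimpleGraph.Walk.cons_isCycle_iff, hab.ne, hbc.ne, hca.ne, hab.ne', hca.ne'])
    simp at this
  refine ⟨?_, tri, ?_, ?_⟩
  · intro v a b c d ha hb hc hd hab hac had hbc hbd hcd
    rw [projGraph_adj hp hs] at ha hb hc hd
    obtain ⟨ja, rfl⟩ := ha
    obtain ⟨jb, rfl⟩ := hb
    obtain ⟨jc, rfl⟩ := hc
    obtain ⟨jd, rfl⟩ := hd
    have h1 : ja ≠ jb := fun e => hab (by rw [e])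
    have h2 : ja ≠ jc := fun e => hac (by rw [e])
    have h3 : ja ≠ jd := fun e => had (by rw [e])
    have h4 : jb ≠ jc := fun e => hbc (by rw [e])
    have h5 : jb ≠ jd := fun e => hbd (by rw [e])
    have h6 : jc ≠ jd := fun e => hcd (by rw [e])
    omega
  · intro a b c d hab hbc hcd hda hac hbd
    have := hcyc a (.cons hab (.cons hbc (.cons hcd (.cons hda .nil)))) (by
      simp [SimpleGraph.Walk.cons_isCycle_iff, hab.ne, hbc.ne, hcd.ne, hda.ne, hab.ne',
        hda.ne', hac, hbd, hac.symm])
    simp at this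
  · intro a b c d e hab hbc hcd hde hea
    have hac : a ≠ c := by
      rintro rfl
      exact tri _ _ _ hcd hde hea
    have had : a ≠ d := by
      rintro rfl
      exact tri _ _ _ hab hbc hcd
    have hbd : b ≠ d := by
      rintro rfl
      exact tri _ _ _ hde hea hab
    have hbe : b ≠ e := by
      rintro rfl
      exact tri _ _ _ hbc hcd hde
    have hce : c ≠ e := by
      rintro rfl
      exact tri _ _ _ hea hab hbc
    have := hcyc a (.cons hab (.cons hbc (.cons hcd (.cons hde (.cons hea .nil))))) (by
      simp [SimpleGraph.Walk.cons_isCycle_iff, hab.ne, hbc.ne, hcd.ne, hde.ne, hea.ne, hab.ne',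
        hea.ne', hac, had, hbd, hbe, hce, hac.symm, had.symm])
    simp at this

theorem isAI_coe_iff {V : Type*} (G : SimpleGraph V) (A : Finset V) :
    IsAI G (A : Set V) ↔
      ∀ a ∈ A, ∀ b ∈ A, ∀ c ∈ A, G.Adj a b → G.Adj a c → b = c := by
  unfold IsAI
  refine forall₂_congr fun a ha => ?_
  have hf : {b | b ∈ (A : Set V) ∧ G.Adj a b}.Finite :=
    A.finite_toSet.subset fun b hb => hb.1
  rw [Set.ncard_le_one hf]
  simp only [Set.mem_ofPred_eq, Finset.mem_coe]
  grind

theorem isIndep_coe_iff {V : Type*} (G : SimpleGraph V) (I : Finset V) :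
    IsIndep G (I : Set V) ↔ ∀ u ∈ I, ∀ v ∈ I, ¬ G.Adj u v := by
  constructor
  · intro h u hu v hv huv
    exact h hu hv huv.ne huv
  · intro h u hu v hv _
    exact h u hu v hv

theorem exists_indep_coe_iff {V : Type*} [Finite V] (G : SimpleGraph V) (A : Finset V) (α : ℕ) :
    (∃ s ⊆ (A : Set V), IsIndep G s ∧ s.ncard = α) ↔
      ∃ I ⊆ A, (∀ u ∈ I, ∀ v ∈ I, ¬ G.Adj u v) ∧ I.card = α := by
  constructor
  · rintro ⟨s, hs, h1, h2⟩
    lift s to Finset V using s.toFinite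
    exact ⟨s, by exact_mod_cast hs, (isIndep_coe_iff G s).mp h1,
      by rwa [Set.ncard_coe_finset] at h2⟩
  · rintro ⟨I, hI, h1, h2⟩
    exact ⟨I, by exact_mod_cast hI, (isIndep_coe_iff G I).mpr h1, by rwa [Set.ncard_coe_finset]⟩

theorem IsMAI.isMaxAI {V : Type*} [Finite V] {G : SimpleGraph V} {A : Finset V}
    (h : IsMAI G (A : Set V)) : IsMaxAI G (indepNum G) A where
  ai := (isAI_coe_iff G A).mp h.1
  indep := (exists_indep_coe_iff G A _).mp h.2.1
  card_le I hI := by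
    refine le_csSup ⟨Nat.card V, ?_⟩ ⟨I, (isIndep_coe_iff G I).mpr hI, Set.ncard_coe_finset I⟩
    rintro _ ⟨s, -, rfl⟩
    exact Set.ncard_le_card s
  max B hB hI := by
    have := h.2.2 B ((isAI_coe_iff G B).mpr hB) ((exists_indep_coe_iff G B _).mpr hI)
    rwa [Set.ncard_coe_finset, Set.ncard_coe_finset] at this

variable {α : ℕ} {A : Finset (Fin n)}

theorem exists_isInner_iff_of_mem (hp : IsPairing σ) (hs : ProjIsSimple σ) {v : Fin n}
    (hv : v ∈ A) : (∃ j, IsInner A σ (v, j)) ↔ ∃ u ∈ A, (projGraph σ).Adj v u := by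
  simp only [IsInner, hv, iff_true, projGraph_adj hp hs]
  grind

theorem exists_isInner_iff_of_notMem (hp : IsPairing σ) (hs : ProjIsSimple σ) {v : Fin n}
    (hv : v ∉ A) : (∃ j, IsInner A σ (v, j)) ↔ ∃ u ∉ A, (projGraph σ).Adj v u := by
  simp only [IsInner, hv, iff_false, projGraph_adj hp hs]
  grind

theorem having_cross_eq_crossing (hp : IsPairing σ) (hs : ProjIsSimple σ) :
    having A (IsCross A σ) = crossing (projGraph σ) A := by
  ext v
  simp only [having, crossing, Finset.mem_filter]
  refine and_congr_right fun hv => ?_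
  rw [← exists_isInner_iff_of_mem hp hs hv]
  constructor
  · rintro ⟨j, h1, h2, h3⟩
    have hA : (σ (v, j)).1 ∉ A := by simpa [IsInner, hv] using h1
    exact ⟨h2, _, hA, (projGraph_adj hp hs _ _).mpr ⟨j, rfl⟩,
      (exists_isInner_iff_of_notMem hp hs hA).mp h3⟩
  · rintro ⟨h2, b, hb, hvb, h3⟩
    obtain ⟨j, rfl⟩ := (projGraph_adj hp hs _ _).mp hvb
    exact ⟨j, by simpa [IsInner, hv] using hb, h2, (exists_isInner_iff_of_notMem hp hs hb).mpr h3⟩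

theorem IsMaxAI.isSelector_inner (h : MemGSixteen σ) (hA : IsMaxAI (projGraph σ) α A) :
    IsSelector σ (IsInner A σ) := by
  obtain ⟨hp, hs, -⟩ := id h
  refine ⟨hp.1, hs.1, fun v j k hj hk => ?_, fun p hp' => ?_⟩
  · refine hs.2 v j k ?_
    have e1 := (projGraph_adj hp hs v _).mpr ⟨j, rfl⟩
    have e2 := (projGraph_adj hp hs v _).mpr ⟨k, rfl⟩
    simp only [IsInner] at hj hk
    by_cases hv : v ∈ A
    · exact hA.ai v hv _ (hj.mpr hv) _ (hk.mpr hv) e1 e2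
    · exact hA.outside (projGraph_shortCycleFree h) hv (fun e => hv (hj.mp e))
        (fun e => hv (hk.mp e)) e1 e2
  · simp only [IsInner, hp.1] at hp' ⊢
    exact hp'.symm

theorem IsMaxAI.isSelector_cross (h : MemGSixteen σ) (hA : IsMaxAI (projGraph σ) α A) :
    IsSelector σ (IsCross A σ) := by
  obtain ⟨hp, hs, -⟩ := id h
  have hG := projGraph_shortCycleFree h
  refine ⟨hp.1, hs.1, fun v j k hj hk => ?_, fun p hp' => ?_⟩
  · refine hs.2 v j k ?_
    have e1 := (projGraph_adj hp hs v _).mpr ⟨j, rfl⟩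
    have e2 := (projGraph_adj hp hs v _).mpr ⟨k, rfl⟩
    obtain ⟨j1, j2, j3⟩ := hj
    obtain ⟨k1, k2, k3⟩ := hk
    simp only at j2 j3 k2 k3
    by_cases hv : v ∈ A
    · have hj : (σ (v, j)).1 ∉ A := by simpa [IsInner, hv] using j1
      have hk : (σ (v, k)).1 ∉ A := by simpa [IsInner, hv] using k1
      rw [exists_isInner_iff_of_mem hp hs hv] at j2
      rw [exists_isInner_iff_of_notMem hp hs hj] at j3
      rw [exists_isInner_iff_of_notMem hp hs hk] at k3
      obtain ⟨a', ha', haa'⟩ := j2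
      obtain ⟨b', hb', hbb'⟩ := j3
      obtain ⟨c', hc', hcc'⟩ := k3
      exact hA.inside_unique hG hv ha' haa' hj hk e1 e2 hb' hc' hbb' hcc'
    · have hj : (σ (v, j)).1 ∈ A := by simpa [IsInner, hv] using j1
      have hk : (σ (v, k)).1 ∈ A := by simpa [IsInner, hv] using k1
      rw [exists_isInner_iff_of_notMem hp hs hv] at j2
      rw [exists_isInner_iff_of_mem hp hs hj] at j3
      rw [exists_isInner_iff_of_mem hp hs hk] at k3
      obtain ⟨a', ha', haa'⟩ := j2
      obtain ⟨b', hb', hbb'⟩ := j3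
      obtain ⟨c', hc', hcc'⟩ := k3
      exact hA.outside_unique hG hv ha' haa' hj hk e1 e2 hb' hc' hbb' hcc'
  · obtain ⟨h1, h2, h3⟩ := hp'
    refine ⟨fun e => h1 ?_, h3, by rwa [hp.1]⟩
    have := (IsMaxAI.isSelector_inner h hA).inv _ e
    rwa [hp.1] at this

/-- The pairs crossing between `A` and its complement, counted from both sides. -/
theorem three_mul_card_sub (h : IsSelector σ (IsInner A σ)) :
    3 * A.card + (having Aᶜ (IsInner A σ)).card = 3 * Aᶜ.card + (having A (IsInner A σ)).card := by
  classical
  have key : ∀ X : Finset (Fin n), 3 * X.card = (having X (IsInner A σ)).card +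
      (Finset.univ.filter fun p : Fin n × Fin 3 => p.1 ∈ X ∧ ¬ IsInner A σ p).card := by
    intro X
    have h1 := h.card_points X
    have h2 := card_filter_fst_mem X
    unfold having
    rw [← h1, ← h2, ← Finset.filter_filter, ← Finset.filter_filter]
    convert (Finset.card_filter_add_card_filter_not (IsInner A σ)).symm
  have hbij : (Finset.univ.filter fun p : Fin n × Fin 3 => p.1 ∈ A ∧ ¬ IsInner A σ p).card =
      (Finset.univ.filter fun p : Fin n × Fin 3 => p.1 ∈ Aᶜ ∧ ¬ IsInner A σ p).card := by
    refine Finset.card_nbij' σ σ ?_ ?_ (fun p _ => h.invol p) (fun p _ => h.invol p) <;>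
    · intro p hp
      rw [Finset.mem_coe, Finset.mem_filter] at hp ⊢
      simp only [Finset.mem_univ, true_and, IsInner, Finset.mem_compl, h.invol] at hp ⊢
      tauto
  have h1 := key A
  have h2 := key Aᶜ
  omega

theorem mem_having_inner_iff (hp : IsPairing σ) (hs : ProjIsSimple σ) (v : Fin n) :
    v ∈ having A (IsInner A σ) ↔ v ∈ A ∧ ∃ u ∈ A, (projGraph σ).Adj v u := by
  simp only [having, Finset.mem_filter]
  exact and_congr_right fun hv => exists_isInner_iff_of_mem hp hs hv

theorem mem_having_inner_compl_iff (hp : IsPairing σ) (hs : ProjIsSimple σ) (v : Fin n) :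
    v ∈ having Aᶜ (IsInner A σ) ↔ v ∈ Aᶜ ∧ ∃ u ∈ Aᶜ, (projGraph σ).Adj v u := by
  simp only [having, Finset.mem_filter, Finset.mem_compl]
  exact and_congr_right fun hv => exists_isInner_iff_of_notMem hp hs hv

/-- A MAI set of size `n / 2 - i` splits the pairing with the expected parameters. -/
theorem IsMaxAI.exists_isSplit (hn : Even n) (h : MemGSixteen σ)
    (hA : IsMaxAI (projGraph σ) α A) :
    ∃ i, i + α ≤ n / 2 ∧ A.card + i = n / 2 ∧
      IsSplit A (n / 2 - α - i) (n / 2 - α + 2 * i) (crossing (projGraph σ) A).card σ ∧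
      (crossing (projGraph σ) A).card ≤ 2 * (n / 2 - α - i) := by
  obtain ⟨hp, hs, -⟩ := id h
  obtain ⟨m, rfl⟩ := hn
  have hin := IsMaxAI.isSelector_inner h hA
  have e1 := three_mul_card_sub hin
  have hc := A.card_add_card_compl
  rw [Fintype.card_fin] at hc
  obtain ⟨I₀, hI₀A, hI₀, hI₀c⟩ := hA.indep
  have e2 := two_mul_card_indep_le (mem_having_inner_iff hp hs) hA.ai hI₀ hI₀A
  obtain ⟨I₁, hI₁A, hI₁, hI₁c⟩ := exists_indep_two_mul_card (mem_having_inner_iff hp hs) hA.ai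
  have e3 := hA.card_le I₁ hI₁
  obtain ⟨I₂, -, hI₂, hI₂c⟩ := exists_indep_two_mul_card
    (mem_having_inner_compl_iff (A := A) hp hs) (by
    intro a ha b hb c hc
    rw [Finset.mem_compl] at ha hb hc
    exact hA.outside (projGraph_shortCycleFree h) ha hb hc)
  have e4 := hA.card_le I₂ hI₂
  have e5 : (crossing (projGraph σ) A).card ≤ (having A (IsInner A σ)).card := by
    rw [← having_cross_eq_crossing hp hs]
    refine Finset.card_le_card fun v hv => ?_
    simp only [having, Finset.mem_filter] at hv ⊢
    obtain ⟨hv, j, hj⟩ := hv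
    exact ⟨hv, hj.2.1⟩
  have e6 : (having Aᶜ (IsInner A σ)).card = 2 * ((m + m) / 2 - α + 2 * (m - A.card)) := by omega
  refine ⟨m - A.card, by omega, by omega, ⟨hin, IsMaxAI.isSelector_cross h hA, by omega,
    by convert e6, by rw [having_cross_eq_crossing hp hs]⟩, by omega⟩

end Graph

section Assembly

theorem descFactorial_cast_eq {N k : ℕ} (h : k ≤ N) :
    (N.descFactorial k : ℝ) = (N.factorial : ℝ) / ((N - k).factorial : ℝ) := by
  rw [eq_div_iff (by positivity), mul_comm]
  exact_mod_cast Nat.factorial_mul_descFactorial h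

/-- The summand of `qfun` without the number of sets and the power of the golden ratio. -/
noncomputable def splitBound (x n i j : ℕ) : ℝ :=
  (((n / 2 - i).factorial : ℝ) * (3 : ℝ) ^ (n - 2 * x - 2 * i) /
    (((2 * x + i - n / 2).factorial : ℝ) * (2 : ℝ) ^ (n / 2 - x - i) *
      ((n / 2 - x - i).factorial : ℝ))) *
  (((n / 2 + i).factorial : ℝ) * (3 : ℝ) ^ (n - 2 * x + 4 * i) /
    (((2 * x - 3 * i - n / 2).factorial : ℝ) * (2 : ℝ) ^ (n / 2 - x + 2 * i) *
      ((n / 2 - x + 2 * i).factorial : ℝ))) *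
  ((n - 2 * i - 2 * x).choose j : ℝ) * ((n - 2 * x + 4 * i).choose j : ℝ) *
  (2 : ℝ) ^ (2 * j) * (j.factorial : ℝ) *
  (((3 * (2 * x - n / 2 - 3 * i)).factorial : ℝ) *
      ((3 * (2 * x - n / 2 + i)).factorial : ℝ) /
    ((3 * (2 * x - n / 2 - 3 * i) - 2 * (n - 2 * i - 2 * x) + j).factorial : ℝ))

theorem cast_le_splitBound {n x i j a N : ℕ} (hn : Even n) (hx : 16 * (n / 2) ≤ 19 * x)
    (hi : i + x ≤ n / 2) (hj : j ≤ 2 * (n / 2 - x - i)) (ha : a + i = n / 2)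
    (h : N ≤ (a.factorial / ((a - 2 * (n / 2 - x - i)).factorial * 2 ^ (n / 2 - x - i) *
        (n / 2 - x - i).factorial)) *
      ((n - a).factorial / ((n - a - 2 * (n / 2 - x + 2 * i)).factorial *
        2 ^ (n / 2 - x + 2 * i) * (n / 2 - x + 2 * i).factorial)) *
      (3 ^ (2 * (n / 2 - x - i) + 2 * (n / 2 - x + 2 * i)) *
      ((2 * (n / 2 - x - i)).choose j * (2 * (n / 2 - x + 2 * i)).choose j * (j.factorial *
      (2 ^ (2 * j) * ((3 * (n - a - 2 * (n / 2 - x + 2 * i))).descFactorial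
        (4 * (n / 2 - x - i) - j) *
      ((3 * (a - 2 * (n / 2 - x - i))).factorial * 1))))))) :
    (N : ℝ) ≤ splitBound x n i j := by
  obtain ⟨m, rfl⟩ := hn
  have hm : (m + m) / 2 = m := by omega
  unfold splitBound
  rw [hm] at h hx hi hj ha ⊢
  obtain ⟨t, rfl⟩ : ∃ t, m = i + x + t := ⟨m - (i + x), by omega⟩
  obtain ⟨b, hb⟩ : ∃ b, 2 * x = 4 * i + t + x + b := ⟨2 * x - (4 * i + t + x), by omega⟩
  obtain rfl : a = x + t := by omega
  rw [show i + x + t + (i + x + t) - (x + t) = 2 * i + x + t by omega,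
    show i + x + t - x - i = t by omega, show x + t - 2 * t = 4 * i + b by omega,
    show i + x + t - x + 2 * i = 3 * i + t by omega,
    show 2 * i + x + t - 2 * (3 * i + t) = b by omega] at h
  rw [show i + x + t - x - i = t by omega, show i + x + t - i = x + t by omega,
    show i + x + t + (i + x + t) - 2 * x - 2 * i = 2 * t by omega,
    show 2 * x + i - (i + x + t) = 4 * i + b by omega,
    show i + x + t + (i + x + t) - 2 * x + 4 * i = 2 * (3 * i + t) by omega,
    show i + x + t + i = 2 * i + x + t by omega,
    show 2 * x - 3 * i - (i + x + t) = b by omega,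
    show i + x + t - x + 2 * i = 3 * i + t by omega,
    show i + x + t + (i + x + t) - 2 * i - 2 * x = 2 * t by omega,
    show 2 * x - (i + x + t) - 3 * i = b by omega,
    show 2 * x - (i + x + t) + i = 4 * i + b by omega,
    show 3 * b - 2 * (2 * t) + j = 3 * b - (4 * t - j) by omega]
  have hd := descFactorial_cast_eq (N := 3 * b) (k := 4 * t - j) (by omega)
  refine (Nat.cast_le.mpr h).trans ?_
  have h1 : (((x + t).factorial / ((4 * i + b).factorial * 2 ^ t * t.factorial) : ℕ) : ℝ) ≤
      ((x + t).factorial : ℝ) / (((4 * i + b).factorial : ℝ) * 2 ^ t * (t.factorial : ℝ)) := by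
    refine Nat.cast_div_le.trans (le_of_eq ?_)
    push_cast
    rfl
  have h2 : (((2 * i + x + t).factorial /
      (b.factorial * 2 ^ (3 * i + t) * (3 * i + t).factorial) : ℕ) : ℝ) ≤
      ((2 * i + x + t).factorial : ℝ) /
        ((b.factorial : ℝ) * 2 ^ (3 * i + t) * ((3 * i + t).factorial : ℝ)) := by
    refine Nat.cast_div_le.trans (le_of_eq ?_)
    push_cast
    rfl
  have h3 := mul_le_mul h1 h2 (Nat.cast_nonneg _) (by positivity)
  rw [Nat.cast_mul, Nat.cast_mul]
  refine (mul_le_mul_of_nonneg_right h3 (Nat.cast_nonneg _)).trans (le_of_eq ?_)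
  rw [Nat.cast_mul, Nat.cast_mul, Nat.cast_mul, Nat.cast_mul, Nat.cast_mul, Nat.cast_mul,
    Nat.cast_mul, hd]
  push_cast
  rw [pow_add]
  ring

theorem card_isSplit_le_splitBound {n x i j : ℕ} (hn : Even n) (hx : 16 * (n / 2) ≤ 19 * x)
    (hi : i + x ≤ n / 2) (hj : j ≤ 2 * (n / 2 - x - i)) {A : Finset (Fin n)}
    (hA : A.card + i = n / 2) (S : Finset (Fin n × Fin 3 → Fin n × Fin 3))
    (hS : ∀ σ ∈ S, IsSplit A (n / 2 - x - i) (n / 2 - x + 2 * i) j σ) :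
    (S.card : ℝ) ≤ splitBound x n i j := by
  have h := card_isSplit_le S hS
  rw [Fintype.card_fin] at h
  exact cast_le_splitBound hn hx hi hj hA h

theorem IsMaxAI.one_le_sum {n α : ℕ} {σ : Fin n × Fin 3 → Fin n × Fin 3} (h : MemGSixteen σ)
    [DecidablePred (IsMaxAI (projGraph σ) α)] {A : Finset (Fin n)}
    (hA : IsMaxAI (projGraph σ) α A) :
    1 ≤ ∑ B ∈ Finset.univ.filter fun B : Finset (Fin n) => IsMaxAI (projGraph σ) α B,
      (1 / 1.618 : ℝ) ^ (crossing (projGraph σ) B).card := by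
  obtain ⟨B, hB, hmax⟩ := (Finset.univ.filter fun B : Finset (Fin n) =>
    IsMaxAI (projGraph σ) α B).exists_max_image (fun B => (crossing (projGraph σ) B).card)
    ⟨A, by simpa using hA⟩
  have h1 := (Finset.mem_filter.mp hB).2.goldenRatio_pow_le (projGraph_shortCycleFree h)
  have hphi : (1.618 : ℝ) ≤ Real.goldenRatio := by
    have : (2.236 : ℝ) ≤ √5 := Real.le_sqrt_of_sq_le (by norm_num)
    rw [Real.goldenRatio]
    linarith
  set k := (crossing (projGraph σ) B).card
  calc (1 : ℝ) = 1.618 ^ k * (1 / 1.618 : ℝ) ^ k := by rw [← mul_pow]; norm_num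
    _ ≤ Real.goldenRatio ^ k * (1 / 1.618 : ℝ) ^ k := by gcongr
    _ ≤ _ := mul_le_mul_of_nonneg_right h1 (by positivity)
    _ ≤ _ := by
      rw [← nsmul_eq_mul]
      exact Finset.card_nsmul_le_sum _ _ _ fun C hC =>
        pow_le_pow_of_le_one (by norm_num) (by norm_num) (hmax C hC)

end Assembly

/-- for even `n > 0` and an integer `x` with `0.454·n < x ≤ 0.45537·n`, the
number of pairings `F ∈ G'_16(n)` such that `π(F)` has a MAI set whose largest independent
subset has size `x` (equivalently, with `α(π(F)) = x`) is at most `q(x,n)`. -/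
theorem card_pairings_with_MAI_le_q (n x : ℕ) (hn : Even n) (hpos : 0 < n)
    (hx1 : 0.454 * (n : ℝ) < (x : ℝ)) (hx2 : (x : ℝ) ≤ 0.45537 * (n : ℝ)) :
    (Nat.card {σ : Fin n × Fin 3 → Fin n × Fin 3 //
        MemGSixteen σ ∧ ∃ A : Set (Fin n), IsMAI (projGraph σ) A ∧
          indepNum (projGraph σ) = x} : ℝ)
      ≤ qfun x n := by
  classical
  have hx : 16 * (n / 2) ≤ 19 * x := by
    have h1 : 8 * (n : ℝ) ≤ 19 * x := by linarith
    have h2 : 8 * n ≤ 19 * x := by exact_mod_cast h1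
    omega
  rw [Nat.card_eq_fintype_card, Fintype.card_subtype]
  set S := Finset.univ.filter fun σ : Fin n × Fin 3 → Fin n × Fin 3 =>
    MemGSixteen σ ∧ ∃ A : Set (Fin n), IsMAI (projGraph σ) A ∧ indepNum (projGraph σ) = x
  -- the contribution of a set `A` to a pairing `σ` with parameters `i` and `j`
  let w : ℕ → ℕ → Finset (Fin n) → (Fin n × Fin 3 → Fin n × Fin 3) → ℝ := fun i j A σ =>
    if A.card + i = n / 2 ∧ IsSplit A (n / 2 - x - i) (n / 2 - x + 2 * i) j σ then
      (1 / 1.618 : ℝ) ^ j else 0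
  have hw : ∀ i j A σ, 0 ≤ w i j A σ := fun i j A σ => by
    simp only [w]
    split_ifs <;> positivity
  have hone : ∀ σ ∈ S, (1 : ℝ) ≤ ∑ A, ∑ i ∈ Finset.range (n / 2 - x + 1),
      ∑ j ∈ Finset.range (n - 2 * x - 2 * i + 1), w i j A σ := by
    intro σ hσ
    obtain ⟨hG, A, hA, hα⟩ := (Finset.mem_filter.mp hσ).2
    lift A to Finset (Fin n) using A.toFinite
    have hA' := hA.isMaxAI
    rw [hα] at hA'
    refine (hA'.one_le_sum hG).trans ?_
    refine (Finset.sum_le_sum fun B hB => ?_).trans (Finset.sum_le_sum_of_subset_of_nonneg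
      (Finset.filter_subset _ _) fun B _ _ => Finset.sum_nonneg fun i _ =>
        Finset.sum_nonneg fun j _ => hw i j B σ)
    obtain ⟨i, hi, hBi, hsplit, hj⟩ := (Finset.mem_filter.mp hB).2.exists_isSplit hn hG
    refine le_trans ?_ (Finset.single_le_sum (a := i) (fun i _ =>
        Finset.sum_nonneg fun j _ => hw i j B σ) (Finset.mem_range.mpr (by omega)))
    refine le_trans ?_ (Finset.single_le_sum (a := (crossing (projGraph σ) B).card)
      (fun j _ => hw i j B σ) (Finset.mem_range.mpr (by omega)))
    simp only [w]
    rw [if_pos ⟨hBi, hsplit⟩]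
  calc (S.card : ℝ) = ∑ σ ∈ S, 1 := by simp
    _ ≤ ∑ σ ∈ S, ∑ A, ∑ i ∈ Finset.range (n / 2 - x + 1),
        ∑ j ∈ Finset.range (n - 2 * x - 2 * i + 1), w i j A σ := Finset.sum_le_sum hone
    _ = ∑ i ∈ Finset.range (n / 2 - x + 1), ∑ j ∈ Finset.range (n - 2 * x - 2 * i + 1),
        ∑ A, ∑ σ ∈ S, w i j A σ := by
      rw [Finset.sum_comm]
      simp_rw [Finset.sum_comm (s := S)]
      rw [Finset.sum_comm]
      refine Finset.sum_congr rfl fun i _ => ?_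
      rw [Finset.sum_comm]
    _ ≤ qfun x n := by
      refine Finset.sum_le_sum fun i hi => Finset.sum_le_sum fun j hj => ?_
      rw [Finset.mem_range] at hi hj
      have hxn : x ≤ n / 2 := by
        have h1 : 2 * (x : ℝ) ≤ n := by linarith
        have h2 : 2 * x ≤ n := by exact_mod_cast h1
        omega
      have hbound : ∀ A : Finset (Fin n), ∑ σ ∈ S, w i j A σ ≤
          if A.card = n / 2 - i then splitBound x n i j * (1 / 1.618 : ℝ) ^ j else 0 := by
        intro A
        split_ifs with hA
        · simp only [w]
          rw [← Finset.sum_filter, Finset.sum_const, nsmul_eq_mul]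
          refine mul_le_mul_of_nonneg_right ?_ (by positivity)
          obtain ⟨m, rfl⟩ := hn
          refine card_isSplit_le_splitBound ⟨m, rfl⟩ hx (by omega) (by omega) (A := A) (by omega) _
            fun σ hσ => (Finset.mem_filter.mp hσ).2.2
        · refine le_of_eq (Finset.sum_eq_zero fun σ _ => ?_)
          simp only [w]
          rw [if_neg]
          omega
      refine (Finset.sum_le_sum fun A _ => hbound A).trans (le_of_eq ?_)
      rw [← Finset.sum_filter, Finset.sum_const, nsmul_eq_mul]
      have : (Finset.univ.filter fun A : Finset (Fin n) => A.card = n / 2 - i).card =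
          n.choose (n / 2 - i) := by
        rw [Finset.univ_filter_card_eq, Finset.card_powersetCard, Finset.card_univ,
          Fintype.card_fin]
      rw [this, splitBound]
      ring
end

section
/- For every (χ,ζ,ξ) ∈ Ω, h(χ,ζ,ξ) ≤ 0.999983. -/
/-- The function `f(χ,ζ)` (real exponentiation, with the convention `0^0 = 1`). -/
noncomputable def ffun (χ ζ : ℝ) : ℝ :=
  ((3 : ℝ) ^ (1 / 2 - 4 * χ + 2 * ζ)
      * (1 - 2 * χ - 2 * ζ) ^ (1 - 2 * χ - 2 * ζ)
      * (1 - 2 * χ + 4 * ζ) ^ (1 - 2 * χ + 4 * ζ)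
      * (6 * χ - 3 / 2 + 3 * ζ) ^ (6 * χ - 3 / 2 + 3 * ζ)
      * (6 * χ - 3 / 2 - 9 * ζ) ^ (6 * χ - 3 / 2 - 9 * ζ)) /
    ((2 * χ + ζ - 1 / 2) ^ (2 * χ + ζ - 1 / 2)
      * (2 : ℝ) ^ (1 - 2 * χ + ζ)
      * (1 / 2 - χ - ζ) ^ (1 / 2 - χ - ζ)
      * (1 / 2 - χ + 2 * ζ) ^ (1 / 2 - χ + 2 * ζ)
      * (2 * χ - 3 * ζ - 1 / 2) ^ (2 * χ - 3 * ζ - 1 / 2))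

/-- The function `g(χ,ζ,ξ)` (real exponentiation, with the convention `0^0 = 1`). -/
noncomputable def gfun (χ ζ ξ : ℝ) : ℝ :=
  ((2 : ℝ) ^ (2 * ξ) * (1 / 1.618) ^ ξ) /
    (ξ ^ ξ
      * (1 - 2 * χ - 2 * ζ - ξ) ^ (1 - 2 * χ - 2 * ζ - ξ)
      * (1 - 2 * χ + 4 * ζ - ξ) ^ (1 - 2 * χ + 4 * ζ - ξ)
      * (10 * χ - 7 / 2 - 5 * ζ + ξ) ^ (10 * χ - 7 / 2 - 5 * ζ + ξ))

/-- The function `h(χ,ζ,ξ) = f(χ,ζ) · g(χ,ζ,ξ)`. -/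
noncomputable def hfun (χ ζ ξ : ℝ) : ℝ := ffun χ ζ * gfun χ ζ ξ

/-- The domain `Ω`. -/
def Omega : Set (ℝ × ℝ × ℝ) :=
  {p | 0.454 < p.1 ∧ p.1 ≤ 0.45537 ∧ 0 ≤ p.2.1 ∧ p.2.1 ≤ 1 / 2 - p.1 ∧
    0 ≤ p.2.2 ∧ p.2.2 ≤ 1 - 2 * p.1 - 2 * p.2.1}

open Real Set in
/-- Quadratic lower bound for the Bregman divergence of `x log x` on `[0, M]`. -/
lemma sq_div_le_bregman_mul_log {x y M : ℝ} (hx : 0 ≤ x) (hy : 0 < y) (hxM : x ≤ M)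
    (hyM : y ≤ M) :
    (x - y) ^ 2 / (2 * M) ≤ x * log x - x * log y - x + y := by
  have hM : 0 < M := hy.trans_le hyM
  let F : ℝ → ℝ := fun z => z * log z - z * log y - z + y - (z - y) ^ 2 / (2 * M)
  have hcont : Continuous F := by
    have := continuous_mul_log
    fun_prop
  have hderiv : ∀ z, 0 < z → HasDerivAt F (log z - log y - (z - y) / M) z := by
    intro z hz
    have h := ((((hasDerivAt_mul_log hz.ne').sub ((hasDerivAt_id z).mul_const (log y))).sub
      (hasDerivAt_id z)).add_const y).sub
      ((((hasDerivAt_id z).sub_const y).pow 2).div_const (2 * M))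
    refine h.congr_deriv ?_
    simp only [id]
    field_simp
    ring
  have hFy : F y = 0 := by simp [F]
  suffices h : F y ≤ F x by
    simp only [hFy, F] at h
    linarith
  rcases le_total y x with hyx | hxy
  · have hmono : MonotoneOn F (Icc y M) := by
      refine monotoneOn_of_hasDerivWithinAt_nonneg
        (f' := fun z => log z - log y - (z - y) / M) (convex_Icc y M) hcont.continuousOn ?_ ?_
      · intro z hz
        rw [interior_Icc] at hz
        exact (hderiv z (hy.trans hz.1)).hasDerivWithinAt
      · intro z hz
        rw [interior_Icc] at hz
        have hz0 : 0 < z := hy.trans hz.1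
        have h1 := one_sub_inv_le_log_of_pos (div_pos hz0 hy)
        rw [log_div hz0.ne' hy.ne', inv_div] at h1
        have h2 : (z - y) / M ≤ (z - y) / z :=
          div_le_div_of_nonneg_left (by linarith [hz.1]) hz0 hz.2.le
        rw [sub_div z y z, div_self hz0.ne'] at h2
        linarith
    exact hmono ⟨le_rfl, hyM⟩ ⟨hyx, hxM⟩ hyx
  · have hanti : AntitoneOn F (Icc 0 y) := by
      refine antitoneOn_of_hasDerivWithinAt_nonpos
        (f' := fun z => log z - log y - (z - y) / M) (convex_Icc 0 y) hcont.continuousOn ?_ ?_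
      · intro z hz
        rw [interior_Icc] at hz
        exact (hderiv z hz.1).hasDerivWithinAt
      · intro z hz
        rw [interior_Icc] at hz
        have h1 := log_le_sub_one_of_pos (div_pos hz.1 hy)
        rw [log_div hz.1.ne' hy.ne'] at h1
        have h2 : (y - z) / M ≤ (y - z) / y :=
          div_le_div_of_nonneg_left (by linarith [hz.2]) hy hyM
        rw [sub_div y z y, div_self hy.ne'] at h2
        have h3 : (z - y) / M = -((y - z) / M) := by ring
        linarith
    exact hanti ⟨hx, hxy⟩ ⟨hy.le, le_rfl⟩ hxy

open Real Set in
/-- Quadratic upper bound for the Bregman divergence of `x log x` on `[m, ∞)`. -/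
lemma bregman_mul_log_le_sq_div {x y m : ℝ} (hm : 0 < m) (hx : m ≤ x) (hy : m ≤ y) :
    x * log x - x * log y - x + y ≤ (x - y) ^ 2 / (2 * m) := by
  have hy0 : 0 < y := hm.trans_le hy
  let F : ℝ → ℝ := fun z => (z - y) ^ 2 / (2 * m) - (z * log z - z * log y - z + y)
  have hcont : Continuous F := by
    have := continuous_mul_log
    fun_prop
  have hderiv : ∀ z, 0 < z → HasDerivAt F ((z - y) / m - (log z - log y)) z := by
    intro z hz
    have h := ((((hasDerivAt_id z).sub_const y).pow 2).div_const (2 * m)).sub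
      ((((hasDerivAt_mul_log hz.ne').sub ((hasDerivAt_id z).mul_const (log y))).sub
      (hasDerivAt_id z)).add_const y)
    refine h.congr_deriv ?_
    simp only [id]
    field_simp
    ring
  have hFy : F y = 0 := by simp [F]
  suffices h : F y ≤ F x by
    simp only [hFy, F] at h
    linarith
  rcases le_total y x with hyx | hxy
  · have hmono : MonotoneOn F (Ici y) := by
      refine monotoneOn_of_hasDerivWithinAt_nonneg
        (f' := fun z => (z - y) / m - (log z - log y)) (convex_Ici y) hcont.continuousOn ?_ ?_
      · intro z hz
        rw [interior_Ici] at hz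
        exact (hderiv z (hy0.trans hz)).hasDerivWithinAt
      · intro z hz
        rw [interior_Ici, mem_Ioi] at hz
        have hz0 : 0 < z := hy0.trans hz
        have h1 := log_le_sub_one_of_pos (div_pos hz0 hy0)
        rw [log_div hz0.ne' hy0.ne'] at h1
        have h2 : (z - y) / y ≤ (z - y) / m :=
          div_le_div_of_nonneg_left (by linarith) hm hy
        rw [sub_div z y y, div_self hy0.ne'] at h2
        linarith
    exact hmono self_mem_Ici hyx hyx
  · have hanti : AntitoneOn F (Icc m y) := by
      refine antitoneOn_of_hasDerivWithinAt_nonpos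
        (f' := fun z => (z - y) / m - (log z - log y)) (convex_Icc m y) hcont.continuousOn ?_ ?_
      · intro z hz
        rw [interior_Icc] at hz
        exact (hderiv z (hm.trans hz.1)).hasDerivWithinAt
      · intro z hz
        rw [interior_Icc] at hz
        have hz0 : 0 < z := hm.trans hz.1
        have h1 := one_sub_inv_le_log_of_pos (div_pos hz0 hy0)
        rw [log_div hz0.ne' hy0.ne', inv_div] at h1
        have h2 : (y - z) / z ≤ (y - z) / m :=
          div_le_div_of_nonneg_left (by linarith [hz.2]) hm hz.1.le
        rw [sub_div y z z, div_self hz0.ne'] at h2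
        have h3 : (z - y) / m = -((y - z) / m) := by ring
        linarith
    exact hanti ⟨hx, hxy⟩ ⟨hy, le_rfl⟩ hxy

open Real in
/-- The two-term log-sum inequality. -/
lemma log_sum_two_le {s t p q : ℝ} (hs : 0 ≤ s) (ht : 0 ≤ t) (hp : 0 < p) (hq : 0 < q) :
    (s + t) * log (s + t) - (s + t) * log (p + q) ≤
      (s * log s - s * log p) + (t * log t - t * log q) := by
  have key : ∀ {x y r : ℝ}, 0 ≤ x → 0 < y → 0 < r →
      x - y * r ≤ x * log x - x * log y - x * log r := by
    intro x y r hx hy hr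
    rcases hx.eq_or_lt with rfl | hx
    · simp only [zero_sub, zero_mul, sub_self]
      have := mul_pos hy hr
      linarith
    · have h := one_sub_inv_le_log_of_pos (div_pos hx (mul_pos hy hr))
      rw [log_div hx.ne' (mul_pos hy hr).ne', log_mul hy.ne' hr.ne', inv_div] at h
      have h2 := mul_le_mul_of_nonneg_left h hx.le
      have h3 : x * (1 - y * r / x) = x - y * r := by field_simp
      rw [h3] at h2
      linarith
  have hpq : 0 < p + q := add_pos hp hq
  rcases (add_nonneg hs ht).eq_or_lt with h0 | h0
  · obtain rfl : s = 0 := by linarith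
    obtain rfl : t = 0 := by linarith
    simp
  · have hr : 0 < (s + t) / (p + q) := div_pos h0 hpq
    have h1 := key hs hp hr
    have h2 := key ht hq hr
    have h3 : p * ((s + t) / (p + q)) + q * ((s + t) / (p + q)) = s + t := by field_simp
    have h4 := log_div h0.ne' hpq.ne'
    rw [h4] at h1 h2
    linarith

open Real in
lemma log_div_mem_Icc_series {x : ℝ} (h₀ : 0 ≤ x) (h : x < 1) :
    2 * (x + x ^ 3 / 3 + x ^ 5 / 5 + x ^ 7 / 7 + x ^ 9 / 9 + x ^ 11 / 11) ≤
        log ((1 + x) / (1 - x)) ∧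
      log ((1 + x) / (1 - x)) ≤
        2 * (x + x ^ 3 / 3 + x ^ 5 / 5 + x ^ 7 / 7 + x ^ 9 / 9 + x ^ 11 / 11
          + x ^ 13 / (1 - x ^ 2)) := by
  have h1 := sum_range_le_log_div h₀ h 6
  have h2 := log_div_le_sum_range_add h₀ h 6
  simp only [Finset.sum_range_succ, Finset.sum_range_zero] at h1 h2
  norm_num at h1 h2
  constructor <;> linarith

open Real in
lemma log_three_bounds : (1.098612283 : ℝ) ≤ log 3 ∧
    log 3 ≤ (1.098612295 : ℝ) := by
  have h := log_div_mem_Icc_series (x := 1 / 7)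
    (by norm_num) (by norm_num)
  have e : log 3 =
      -log ((1 + 1 / 7) / (1 - 1 / 7)) + 2 * log 2 := by
    rw [← log_inv, show (2 : ℝ) = ((2 : ℕ) : ℝ) by norm_num, ← log_pow,
      ← log_mul (by norm_num) (by norm_num)]
    norm_num
  norm_num at h e ⊢
  constructor <;> linarith [h.1, h.2, log_two_gt_d9, log_two_lt_d9]

open Real in
lemma log_bounds_1618 : (0.481190813 : ℝ) ≤ log 1.618 ∧
    log 1.618 ≤ (0.481190825 : ℝ) := by
  have h := log_div_mem_Icc_series (x := 191 / 1809)
    (by norm_num) (by norm_num)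
  have e : log 1.618 =
      -log ((1 + 191 / 1809) / (1 - 191 / 1809)) + 1 * log 2 := by
    rw [← log_inv, show (1 : ℝ) = ((1 : ℕ) : ℝ) by norm_num, ← log_pow,
      ← log_mul (by norm_num) (by norm_num)]
    norm_num
  norm_num at h e ⊢
  constructor <;> linarith [h.1, h.2, log_two_gt_d9, log_two_lt_d9]

open Real in
lemma log_bounds_046256 : (-3.073564100 : ℝ) ≤ log 0.046256 ∧
    log 0.046256 ≤ (-3.073564088 : ℝ) := by
  have h := log_div_mem_Icc_series (x := 4061 / 27189)
    (by norm_num) (by norm_num)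
  have e : log 0.046256 =
      -log ((1 + 4061 / 27189) / (1 - 4061 / 27189)) - 4 * log 2 := by
    rw [← log_inv, eq_sub_iff_add_eq, show (4 : ℝ) = ((4 : ℕ) : ℝ) by norm_num, ← log_pow,
      ← log_mul (by norm_num) (by norm_num)]
    norm_num
  norm_num at h e ⊢
  constructor <;> linarith [h.1, h.2, log_two_gt_d9, log_two_lt_d9]

open Real in
lemma log_bounds_183488 : (-1.695606015 : ℝ) ≤ log 0.183488 ∧
    log 0.183488 ≤ (-1.695606003 : ℝ) := by
  have h := log_div_mem_Icc_series (x := 4157 / 27093)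
    (by norm_num) (by norm_num)
  have e : log 0.183488 =
      -log ((1 + 4157 / 27093) / (1 - 4157 / 27093)) - 2 * log 2 := by
    rw [← log_inv, eq_sub_iff_add_eq, show (2 : ℝ) = ((2 : ℕ) : ℝ) by norm_num, ← log_pow,
      ← log_mul (by norm_num) (by norm_num)]
    norm_num
  norm_num at h e ⊢
  constructor <;> linarith [h.1, h.2, log_two_gt_d9, log_two_lt_d9]

open Real in
lemma log_bounds_430872 : (-0.841944223 : ℝ) ≤ log 0.430872 ∧
    log 0.430872 ≤ (-0.841944211 : ℝ) := by
  have h := log_div_mem_Icc_series (x := 8641 / 116359)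
    (by norm_num) (by norm_num)
  have e : log 0.430872 =
      -log ((1 + 8641 / 116359) / (1 - 8641 / 116359)) - 1 * log 2 := by
    rw [← log_inv, eq_sub_iff_add_eq, show (1 : ℝ) = ((1 : ℕ) : ℝ) by norm_num, ← log_pow,
      ← log_mul (by norm_num) (by norm_num)]
    norm_num
  norm_num at h e ⊢
  constructor <;> linarith [h.1, h.2, log_two_gt_d9, log_two_lt_d9]

open Real in
lemma log_bounds_339384 : (-1.080623075 : ℝ) ≤ log 0.339384 ∧
    log 0.339384 ≤ (-1.080623063 : ℝ) := by
  have h := log_div_mem_Icc_series (x := 11173 / 73673)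
    (by norm_num) (by norm_num)
  have e : log 0.339384 =
      log ((1 + 11173 / 73673) / (1 - 11173 / 73673)) - 2 * log 2 := by
    rw [eq_sub_iff_add_eq, show (2 : ℝ) = ((2 : ℕ) : ℝ) by norm_num, ← log_pow,
      ← log_mul (by norm_num) (by norm_num)]
    norm_num
  norm_num at h e ⊢
  constructor <;> linarith [h.1, h.2, log_two_gt_d9, log_two_lt_d9]

open Real in
lemma log_bounds_014248 : (-4.251138739 : ℝ) ≤ log 0.014248 ∧
    log 0.014248 ≤ (-4.251138727 : ℝ) := by
  have h := log_div_mem_Icc_series (x := 1377 / 29873)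
    (by norm_num) (by norm_num)
  have e : log 0.014248 =
      -log ((1 + 1377 / 29873) / (1 - 1377 / 29873)) - 6 * log 2 := by
    rw [← log_inv, eq_sub_iff_add_eq, show (6 : ℝ) = ((6 : ℕ) : ℝ) by norm_num, ← log_pow,
      ← log_mul (by norm_num) (by norm_num)]
    norm_num
  norm_num at h e ⊢
  constructor <;> linarith [h.1, h.2, log_two_gt_d9, log_two_lt_d9]

open Real in
lemma log_bounds_032008 : (-3.441769413 : ℝ) ≤ log 0.032008 ∧
    log 0.032008 ≤ (-3.441769401 : ℝ) := by
  have h := log_div_mem_Icc_series (x := 379 / 31629)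
    (by norm_num) (by norm_num)
  have e : log 0.032008 =
      log ((1 + 379 / 31629) / (1 - 379 / 31629)) - 5 * log 2 := by
    rw [eq_sub_iff_add_eq, show (5 : ℝ) = ((5 : ℕ) : ℝ) by norm_num, ← log_pow,
      ← log_mul (by norm_num) (by norm_num)]
    norm_num
  norm_num at h e ⊢
  constructor <;> linarith [h.1, h.2, log_two_gt_d9, log_two_lt_d9]

open Real in
lemma log_bounds_169240 : (-1.776437459 : ℝ) ≤ log 0.16924 ∧
    log 0.16924 ≤ (-1.776437447 : ℝ) := by
  have h := log_div_mem_Icc_series (x := 553 / 3678)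
    (by norm_num) (by norm_num)
  have e : log 0.16924 =
      log ((1 + 553 / 3678) / (1 - 553 / 3678)) - 3 * log 2 := by
    rw [eq_sub_iff_add_eq, show (3 : ℝ) = ((3 : ℕ) : ℝ) by norm_num, ← log_pow,
      ← log_mul (by norm_num) (by norm_num)]
    norm_num
  norm_num at h e ⊢
  constructor <;> linarith [h.1, h.2, log_two_gt_d9, log_two_lt_d9]

open Real in
lemma log_bounds_939888 : (-0.061994566 : ℝ) ≤ log 0.939888 ∧
    log 0.939888 ≤ (-0.061994554 : ℝ) := by
  have h := log_div_mem_Icc_series (x := 3757 / 121243)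
    (by norm_num) (by norm_num)
  have e : log 0.939888 =
      -log ((1 + 3757 / 121243) / (1 - 3757 / 121243)) - 0 * log 2 := by
    rw [← log_inv, eq_sub_iff_add_eq, show (0 : ℝ) = ((0 : ℕ) : ℝ) by norm_num, ← log_pow,
      ← log_mul (by norm_num) (by norm_num)]
    norm_num
  norm_num at h e ⊢
  constructor <;> linarith [h.1, h.2, log_two_gt_d9, log_two_lt_d9]

open Real in
/-- The logarithm of `hfun`, written with `a = 1 - 2χ - 2ζ`, `b = 1 - 2χ + 4ζ`,
`c = 2χ + ζ - 1/2` and `d = 2χ - 3ζ - 1/2`. -/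
noncomputable def logH (χ ζ ξ : ℝ) : ℝ :=
  (8 * χ - 4 * ζ - 5 / 2) * log 3 + ξ * (2 * log 2 - log 1.618)
    + (1 - 2 * χ - 2 * ζ) * log (1 - 2 * χ - 2 * ζ) / 2
    + (1 - 2 * χ + 4 * ζ) * log (1 - 2 * χ + 4 * ζ) / 2
    + 2 * ((2 * χ + ζ - 1 / 2) * log (2 * χ + ζ - 1 / 2))
    + 2 * ((2 * χ - 3 * ζ - 1 / 2) * log (2 * χ - 3 * ζ - 1 / 2))
    - ξ * log ξ - (1 - 2 * χ - 2 * ζ - ξ) * log (1 - 2 * χ - 2 * ζ - ξ)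
    - (1 - 2 * χ + 4 * ζ - ξ) * log (1 - 2 * χ + 4 * ζ - ξ)
    - (10 * χ - 7 / 2 - 5 * ζ + ξ) * log (10 * χ - 7 / 2 - 5 * ζ + ξ)

open Real in
lemma rpow_self_eq_exp_mul_log {x : ℝ} (hx : 0 ≤ x) : x ^ x = exp (x * log x) := by
  rcases hx.eq_or_lt with rfl | hx
  · simp
  · rw [rpow_def_of_pos hx, mul_comm]

open Real in
lemma mul_mul_log_mul {k : ℝ} (hk : 0 < k) (x : ℝ) :
    k * x * log (k * x) = k * (x * log x) + k * x * log k := by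
  rcases eq_or_ne x 0 with rfl | hx
  · simp
  · rw [log_mul hk.ne' hx]
    ring

open Real in
lemma hfun_eq_exp_logH {χ ζ ξ : ℝ} (hmem : (χ, ζ, ξ) ∈ Omega) :
    hfun χ ζ ξ = exp (logH χ ζ ξ) := by
  obtain ⟨h1, h2, h3, h4, h5, h6⟩ := hmem
  dsimp only at h1 h2 h3 h4 h5 h6
  norm_num at h1 h2
  have hc : 6 * χ - 3 / 2 + 3 * ζ = 3 * (2 * χ + ζ - 1 / 2) := by ring
  have hd : 6 * χ - 3 / 2 - 9 * ζ = 3 * (2 * χ - 3 * ζ - 1 / 2) := by ring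
  have ha : 1 / 2 - χ - ζ = 1 / 2 * (1 - 2 * χ - 2 * ζ) := by ring
  have hb : 1 / 2 - χ + 2 * ζ = 1 / 2 * (1 - 2 * χ + 4 * ζ) := by ring
  have hlog : log (1 / 2 : ℝ) = -log 2 := by rw [one_div, log_inv]
  have hlog' : log (1 / 1.618 : ℝ) = -log 1.618 := by rw [one_div, log_inv]
  rw [hfun, ffun, gfun, hc, hd, ha, hb,
    rpow_self_eq_exp_mul_log (x := 1 - 2 * χ - 2 * ζ) (by linarith),
    rpow_self_eq_exp_mul_log (x := 1 - 2 * χ + 4 * ζ) (by linarith),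
    rpow_self_eq_exp_mul_log (x := 3 * (2 * χ + ζ - 1 / 2)) (by linarith),
    rpow_self_eq_exp_mul_log (x := 3 * (2 * χ - 3 * ζ - 1 / 2)) (by linarith),
    rpow_self_eq_exp_mul_log (x := 2 * χ + ζ - 1 / 2) (by linarith),
    rpow_self_eq_exp_mul_log (x := 1 / 2 * (1 - 2 * χ - 2 * ζ)) (by linarith),
    rpow_self_eq_exp_mul_log (x := 1 / 2 * (1 - 2 * χ + 4 * ζ)) (by linarith),
    rpow_self_eq_exp_mul_log (x := 2 * χ - 3 * ζ - 1 / 2) (by linarith),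
    rpow_self_eq_exp_mul_log (x := ξ) h5,
    rpow_self_eq_exp_mul_log (x := 1 - 2 * χ - 2 * ζ - ξ) (by linarith),
    rpow_self_eq_exp_mul_log (x := 1 - 2 * χ + 4 * ζ - ξ) (by linarith),
    rpow_self_eq_exp_mul_log (x := 10 * χ - 7 / 2 - 5 * ζ + ξ) (by linarith),
    rpow_def_of_pos (x := 3) (by norm_num), rpow_def_of_pos (x := 2) (by norm_num),
    rpow_def_of_pos (x := 2) (by norm_num), rpow_def_of_pos (x := 1 / 1.618) (by norm_num),
    mul_mul_log_mul (by norm_num), mul_mul_log_mul (by norm_num),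
    mul_mul_log_mul (by norm_num), mul_mul_log_mul (by norm_num), hlog, hlog']
  simp only [← exp_add, ← exp_sub]
  rw [logH]
  congr 1
  ring

open Real in
/-- First-order expansion of `logH` at `(0.454, 0.022872, 0.014248)` with a quadratic remainder. -/
lemma logH_le_quadratic {χ ζ ξ u v w : ℝ} (hmem : (χ, ζ, ξ) ∈ Omega) (hu : u = χ - 0.454)
    (hv : v = ζ - 0.022872) (hw : w = ξ - 0.014248) :
    logH χ ζ ξ ≤
      ((8 * 0.454 - 4 * 0.022872 - 5 / 2) * log 3 + 0.014248 * (2 * log 2 - log 1.618)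
        + 0.046256 * log 0.046256 / 2 + 0.183488 * log 0.183488 / 2
        + 2 * (0.430872 * log 0.430872) + 2 * (0.339384 * log 0.339384)
        - 0.014248 * log 0.014248 - 0.032008 * log 0.032008 - 0.16924 * log 0.16924
        - 0.939888 * log 0.939888)
      + u * (8 * log 3 - log 0.046256 - log 0.183488 + 4 * log 0.430872 + 4 * log 0.339384
        + 2 * log 0.032008 + 2 * log 0.16924 - 10 * log 0.939888)
      + v * (-4 * log 3 - log 0.046256 + 2 * log 0.183488 + 2 * log 0.430872
        - 6 * log 0.339384 + 2 * log 0.032008 - 4 * log 0.16924 + 5 * log 0.939888)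
      + w * (2 * log 2 - log 1.618 - log 0.014248 + log 0.032008 + log 0.16924
        - log 0.939888)
      + (125 / 51 * (2 * u + v) ^ 2 + 100 / 27 * (2 * u - 3 * v) ^ 2
        - 125 / 46 * (2 * u + 2 * v + w) ^ 2 - 125 / 138 * (2 * u - 4 * v + w) ^ 2
        - 625 / 1429 * (10 * u - 5 * v + w) ^ 2) := by
  obtain ⟨h1, h2, h3, h4, h5, h6⟩ := hmem
  dsimp only at h1 h2 h3 h4 h5 h6
  norm_num at h1 h2
  have hA := log_sum_two_le (s := ξ) (t := 1 - 2 * χ - 2 * ζ - ξ) (p := 0.014248)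
    (q := 0.032008) h5 (by linarith) (by norm_num) (by norm_num)
  rw [add_sub_cancel, show (0.014248 + 0.032008 : ℝ) = 0.046256 by norm_num] at hA
  have hS := sq_div_le_bregman_mul_log (x := 1 - 2 * χ - 2 * ζ - ξ) (y := 0.032008)
    (M := 0.092) (by linarith) (by norm_num) (by linarith) (by norm_num)
  have hB := log_sum_two_le (s := ξ) (t := 1 - 2 * χ + 4 * ζ - ξ) (p := 0.014248)
    (q := 0.16924) h5 (by linarith) (by norm_num) (by norm_num)
  rw [add_sub_cancel, show (0.014248 + 0.16924 : ℝ) = 0.183488 by norm_num] at hB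
  have hR := sq_div_le_bregman_mul_log (x := 1 - 2 * χ + 4 * ζ - ξ) (y := 0.16924)
    (M := 0.276) (by linarith) (by norm_num) (by linarith) (by norm_num)
  have hE := sq_div_le_bregman_mul_log (x := 10 * χ - 7 / 2 - 5 * ζ + ξ) (y := 0.939888)
    (M := 1.1432) (by linarith) (by norm_num) (by linarith) (by norm_num)
  have hC := bregman_mul_log_le_sq_div (x := 2 * χ + ζ - 1 / 2) (y := 0.430872)
    (m := 0.408) (by norm_num) (by linarith) (by norm_num)
  have hD := bregman_mul_log_le_sq_div (x := 2 * χ - 3 * ζ - 1 / 2) (y := 0.339384)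
    (m := 0.27) (by norm_num) (by linarith) (by norm_num)
  rw [logH]
  generalize log (1 - 2 * χ - 2 * ζ) = LA at *
  generalize log (1 - 2 * χ + 4 * ζ) = LB at *
  generalize log (2 * χ + ζ - 1 / 2) = LC at *
  generalize log (2 * χ - 3 * ζ - 1 / 2) = LD at *
  generalize log (1 - 2 * χ - 2 * ζ - ξ) = LT at *
  generalize log (1 - 2 * χ + 4 * ζ - ξ) = LR at *
  generalize log (10 * χ - 7 / 2 - 5 * ζ + ξ) = LE at *
  subst hu hv hw
  linear_combination hA / 2 + hB / 2 + 2 * hC + 2 * hD + hS / 2 + hR / 2 + hE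

open Real in
lemma logH_le {χ ζ ξ : ℝ} (hmem : (χ, ζ, ξ) ∈ Omega) : logH χ ζ ξ ≤ -0.0000178 := by
  obtain ⟨u, hu⟩ : ∃ u, u = χ - 0.454 := ⟨_, rfl⟩
  obtain ⟨v, hv⟩ : ∃ v, v = ζ - 0.022872 := ⟨_, rfl⟩
  obtain ⟨w, hw⟩ : ∃ w, w = ξ - 0.014248 := ⟨_, rfl⟩
  have hquad := logH_le_quadratic hmem hu hv hw
  obtain ⟨h1, h2, h3, h4, h5, h6⟩ := hmem
  dsimp only at h1 h2 h3 h4 h5 h6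
  have hu0 : 0 ≤ u := by linarith
  have hv0 : -0.05 ≤ v := by linarith
  have hv1 : v ≤ 0.05 := by linarith
  have hw0 : -0.02 ≤ w := by linarith
  have l2l := log_two_gt_d9
  have l2u := log_two_lt_d9
  obtain ⟨l3l, l3u⟩ := log_three_bounds
  obtain ⟨lpl, lpu⟩ := log_bounds_1618
  obtain ⟨lal, lau⟩ := log_bounds_046256
  obtain ⟨lbl, lbu⟩ := log_bounds_183488
  obtain ⟨lcl, lcu⟩ := log_bounds_430872
  obtain ⟨ldl, ldu⟩ := log_bounds_339384
  obtain ⟨lsl, lsu⟩ := log_bounds_014248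
  obtain ⟨ltl, ltu⟩ := log_bounds_032008
  obtain ⟨lrl, lru⟩ := log_bounds_169240
  obtain ⟨lel, leu⟩ := log_bounds_939888
  generalize hGu : 8 * log 3 - log 0.046256 - log 0.183488 + 4 * log 0.430872
    + 4 * log 0.339384 + 2 * log 0.032008 + 2 * log 0.16924 - 10 * log 0.939888 = Gu at hquad
  generalize hGv : -4 * log 3 - log 0.046256 + 2 * log 0.183488 + 2 * log 0.430872
    - 6 * log 0.339384 + 2 * log 0.032008 - 4 * log 0.16924 + 5 * log 0.939888 = Gv at hquad
  generalize hGw : 2 * log 2 - log 1.618 - log 0.014248 + log 0.032008 + log 0.16924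
    - log 0.939888 = Gw at hquad
  have hK0 : (8 * 0.454 - 4 * 0.022872 - 5 / 2) * log 3 + 0.014248 * (2 * log 2 - log 1.618)
        + 0.046256 * log 0.046256 / 2 + 0.183488 * log 0.183488 / 2
        + 2 * (0.430872 * log 0.430872) + 2 * (0.339384 * log 0.339384)
        - 0.014248 * log 0.014248 - 0.032008 * log 0.032008 - 0.16924 * log 0.16924
        - 0.939888 * log 0.939888 ≤ -0.0000179 := by linarith
  have hGu' : u * Gu ≤ u * -3.9 := mul_le_mul_of_nonneg_left (by linarith) hu0
  have hGv' : Gv ^ 2 ≤ 0.00002 ^ 2 := sq_le_sq' (by linarith) (by linarith)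
  have hGw' : Gw ^ 2 ≤ 0.00005 ^ 2 := sq_le_sq' (by linarith) (by linarith)
  have hvG : v * Gv ≤ 0.05 * v ^ 2 + 5 * Gv ^ 2 := by linarith [sq_nonneg (v - 10 * Gv)]
  have hwG : w * Gw ≤ 0.05 * w ^ 2 + 5 * Gw ^ 2 := by linarith [sq_nonneg (w - 10 * Gw)]
  have huv : u * v ≤ u * 0.05 := mul_le_mul_of_nonneg_left hv1 hu0
  have huw : u * -0.02 ≤ u * w := mul_le_mul_of_nonneg_left hw0 hu0
  have huu : 0 ≤ u ^ 2 := sq_nonneg u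
  linarith [sq_nonneg (w - 0.1 * v), sq_nonneg v, sq_nonneg w]

/-- for every `(χ,ζ,ξ) ∈ Ω`, `h(χ,ζ,ξ) ≤ 0.999983`. -/
theorem hfun_le_on_Omega (χ ζ ξ : ℝ) (hmem : (χ, ζ, ξ) ∈ Omega) :
    hfun χ ζ ξ ≤ 0.999983 := by
  have h : Real.exp (-0.0000178) ≤ 0.999983 := by
    rw [← Real.le_log_iff_exp_le (by norm_num)]
    have := Real.one_sub_inv_le_log_of_pos (show (0 : ℝ) < 0.999983 by norm_num)
    norm_num at this ⊢
    linarith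
  rw [hfun_eq_exp_logH hmem]
  exact (Real.exp_le_exp.mpr (logH_le hmem)).trans h
end

section
/- For all real ζ and ξ with 0 ≤ ζ ≤ 0.046 and 0 ≤ ξ ≤ 0.092 − 2ζ, one has h(0.454, ζ, ξ) ≤ 0.999983. -/
open Set in
/-- A weighted sum of functions `x * log x` lies below its first-order expansion at `a` provided its
second derivative along the segment from `a` to `b` is nonpositive. -/
theorem sum_mul_log_le_of_second_deriv_nonpos {ι : Type*} (s : Finset ι) (c a b : ι → ℝ)
    (ha : ∀ i ∈ s, 0 < a i) (hb : ∀ i ∈ s, 0 ≤ b i)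
    (h : ∀ t ∈ Ioo (0 : ℝ) 1,
      ∑ i ∈ s, c i * ((b i - a i) ^ 2 / (a i + t * (b i - a i))) ≤ 0) :
    ∑ i ∈ s, c i * (b i * Real.log (b i)) ≤
      ∑ i ∈ s, c i * (b i * Real.log (a i) + b i - a i) := by
  have hpos : ∀ t ∈ Ico (0 : ℝ) 1, ∀ i ∈ s, 0 < a i + t * (b i - a i) := by
    intro t ht i hi
    nlinarith [mul_pos (sub_pos.2 ht.2) (ha i hi), mul_nonneg ht.1 (hb i hi)]
  have hline : ∀ i t, HasDerivAt (fun t : ℝ => a i + t * (b i - a i)) (b i - a i) t := by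
    intro i t
    simpa using ((hasDerivAt_id t).mul_const (b i - a i)).const_add (a i)
  have hd : ∀ t ∈ Ico (0 : ℝ) 1, HasDerivAt
      (fun t => ∑ i ∈ s, c i * ((a i + t * (b i - a i)) * Real.log (a i + t * (b i - a i))))
      (∑ i ∈ s, c i * ((Real.log (a i + t * (b i - a i)) + 1) * (b i - a i))) t := by
    intro t ht
    refine HasDerivAt.fun_sum fun i hi => HasDerivAt.const_mul _ ?_
    exact (Real.hasDerivAt_mul_log (hpos t ht i hi).ne').comp t (hline i t)
  have hdd : ∀ t ∈ Ioo (0 : ℝ) 1, HasDerivAt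
      (fun t => ∑ i ∈ s, c i * ((Real.log (a i + t * (b i - a i)) + 1) * (b i - a i)))
      (∑ i ∈ s, c i * ((b i - a i) ^ 2 / (a i + t * (b i - a i)))) t := by
    intro t ht
    refine HasDerivAt.fun_sum fun i hi => HasDerivAt.const_mul _ ?_
    have := (((hline i t).log (hpos t (Ioo_subset_Ico_self ht) i hi).ne').add_const 1).mul_const
      (b i - a i)
    convert this using 1
    ring
  have hconc : ConcaveOn ℝ (Icc (0 : ℝ) 1)
      (fun t => ∑ i ∈ s, c i * ((a i + t * (b i - a i)) * Real.log (a i + t * (b i - a i)))) := by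
    refine concaveOn_of_hasDerivWithinAt2_nonpos (convex_Icc 0 1) ?_
      (fun t ht => (hd t ?_).hasDerivWithinAt) (fun t ht => (hdd t ?_).hasDerivWithinAt)
      fun t ht => h t ?_
    · refine Continuous.continuousOn (continuous_finsetSum _ fun i _ => continuous_const.mul ?_)
      exact Real.continuous_mul_log.comp (by fun_prop)
    all_goals rw [interior_Icc] at ht
    · exact Ioo_subset_Ico_self ht
    · exact ht
    · exact ht
  have hslope := hconc.slope_le_of_hasDerivAt (left_mem_Icc.2 zero_le_one)
    (right_mem_Icc.2 zero_le_one) zero_lt_one (hd 0 (left_mem_Ico.2 zero_lt_one))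
  simp only [slope_def_field, zero_mul, add_zero, one_mul, add_sub_cancel, sub_zero, div_one]
    at hslope
  rw [sub_le_iff_le_add, ← Finset.sum_add_distrib] at hslope
  refine hslope.trans_eq (Finset.sum_congr rfl fun i _ => ?_)
  ring

theorem add_sq_div_add_le {a b : ℝ} (ha : 0 < a) (hb : 0 < b) (x y : ℝ) :
    (x + y) ^ 2 / (a + b) ≤ x ^ 2 / a + y ^ 2 / b := by
  have h : x ^ 2 / a + y ^ 2 / b - (x + y) ^ 2 / (a + b) =
      (b * x - a * y) ^ 2 / (a * b * (a + b)) := by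
    field_simp
    ring
  have : 0 ≤ (b * x - a * y) ^ 2 / (a * b * (a + b)) := by positivity
  linarith

theorem sum_inv_le_of_mem {ζ : ℝ} (h0 : 0 ≤ ζ) (h1 : ζ < 0.046) :
    2 / (0.408 + ζ) + 18 / (0.408 - 3 * ζ) + 8 / (0.092 + 4 * ζ) ≤
      2 / (0.092 - 2 * ζ) + 16 / (0.115 + 3.5 * ζ) := by
  have hE : 2 / (0.408 + ζ) ≤ 5 := by
    rw [div_le_iff₀ (by linarith)]
    linarith
  have hF : 18 / (0.408 - 3 * ζ) ≤ 44.2 + 491 * ζ := by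
    rw [div_le_iff₀ (by linarith)]
    nlinarith
  have hA : 15.5 + 1111 * ζ ≤ 2 / (0.092 - 2 * ζ) := by
    rw [le_div_iff₀ (by linarith)]
    nlinarith [sq_nonneg (ζ - 0.016)]
  have hB : 33.7 - 620 * ζ ≤ 16 / (0.115 + 3.5 * ζ) - 8 / (0.092 + 4 * ζ) := by
    rw [div_sub_div _ _ (by positivity) (by positivity), le_div_iff₀ (by positivity)]
    nlinarith [mul_nonneg h0 (sub_nonneg.2 h1.le), pow_nonneg h0 3]
  linarith

/-- The Hessian of the entropy part of `log (hfun 0.454 ζ ξ)` is negative semidefinite. -/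
theorem entropy_hessian_nonpos {ζ ξ : ℝ} (hζ : 0 ≤ ζ) (hξ : 0 < ξ) (hA : 0 < 0.092 - 2 * ζ - ξ)
    (u v : ℝ) :
    2 * (u ^ 2 / (0.408 + ζ)) + 2 * ((-3 * u) ^ 2 / (0.408 - 3 * ζ))
      + 1 / 2 * ((-2 * u) ^ 2 / (0.092 - 2 * ζ)) + 1 / 2 * ((4 * u) ^ 2 / (0.092 + 4 * ζ))
      ≤ v ^ 2 / ξ + (-2 * u - v) ^ 2 / (0.092 - 2 * ζ - ξ) + (4 * u - v) ^ 2 / (0.092 + 4 * ζ - ξ)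
        + (-5 * u + v) ^ 2 / (1.04 - 5 * ζ + ξ) := by
  have hA' : 0 < 0.092 - 2 * ζ := by linarith
  have hB : 0 < 0.092 + 4 * ζ - ξ := by linarith
  have hG : 0 ≤ (-5 * u + v) ^ 2 / (1.04 - 5 * ζ + ξ) :=
    div_nonneg (sq_nonneg _) (by linarith)
  set A := 0.092 - 2 * ζ with hAdef
  set w := v + 2 * (ξ / A) * u with hw
  have hsplit : 4 * u ^ 2 / A + w ^ 2 / (A / 4) ≤ v ^ 2 / ξ + (-2 * u - v) ^ 2 / (A - ξ) := by
    have h : v ^ 2 / ξ + (-2 * u - v) ^ 2 / (A - ξ) - (4 * u ^ 2 / A + w ^ 2 / (A / 4)) =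
        w ^ 2 * (A - 2 * ξ) ^ 2 / (A * ξ * (A - ξ)) := by
      rw [hw]
      field_simp
      ring
    have : 0 ≤ w ^ 2 * (A - 2 * ξ) ^ 2 / (A * ξ * (A - ξ)) := by positivity
    linarith
  have hdiv : (4 * u - v) ^ 2 / (0.092 + 4 * ζ) ≤ (4 * u - v) ^ 2 / (0.092 + 4 * ζ - ξ) := by
    gcongr
    linarith
  have htitu := add_sq_div_add_le (a := A / 4) (b := 0.092 + 4 * ζ) (by positivity)
    (by positivity) w (4 * u - v)
  have hnum : 16 * u ^ 2 / (0.115 + 3.5 * ζ) ≤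
      (w + (4 * u - v)) ^ 2 / (A / 4 + (0.092 + 4 * ζ)) := by
    have hr : 0 ≤ ξ / A := by positivity
    have hden : A / 4 + (0.092 + 4 * ζ) = 0.115 + 3.5 * ζ := by rw [hAdef]; ring
    rw [hden]
    gcongr
    have : (w + (4 * u - v)) ^ 2 = (4 + 2 * (ξ / A)) ^ 2 * u ^ 2 := by rw [hw]; ring
    rw [this]
    gcongr
    nlinarith
  have hone := mul_le_mul_of_nonneg_left (sum_inv_le_of_mem hζ (by linarith)) (sq_nonneg u)
  have e1 : 2 * (u ^ 2 / (0.408 + ζ)) + 2 * ((-3 * u) ^ 2 / (0.408 - 3 * ζ))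
      + 1 / 2 * ((-2 * u) ^ 2 / A) + 1 / 2 * ((4 * u) ^ 2 / (0.092 + 4 * ζ)) =
      u ^ 2 * (2 / (0.408 + ζ) + 18 / (0.408 - 3 * ζ) + 8 / (0.092 + 4 * ζ))
        + 2 * u ^ 2 / A := by ring
  have e2 : u ^ 2 * (2 / (0.092 - 2 * ζ) + 16 / (0.115 + 3.5 * ζ)) =
      2 * u ^ 2 / A + 16 * u ^ 2 / (0.115 + 3.5 * ζ) := by rw [hAdef]; ring
  have e3 : 4 * u ^ 2 / A = 2 * u ^ 2 / A + 2 * u ^ 2 / A := by ring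
  linarith

theorem le_log_div_of_le_sum {x c : ℝ} (n : ℕ) (h0 : 0 ≤ x) (h1 : x < 1)
    (hc : c ≤ 2 * ∑ i ∈ Finset.range n, x ^ (2 * i + 1) / (2 * i + 1)) :
    c ≤ Real.log ((1 + x) / (1 - x)) := by
  linarith [Real.sum_range_le_log_div h0 h1 n]

theorem log_div_le_of_sum_le {x c : ℝ} (n : ℕ) (h0 : 0 ≤ x) (h1 : x < 1)
    (hc : 2 * (∑ i ∈ Finset.range n, x ^ (2 * i + 1) / (2 * i + 1)
      + x ^ (2 * n + 1) / (1 - x ^ 2)) ≤ c) :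
    Real.log ((1 + x) / (1 - x)) ≤ c := by
  linarith [Real.log_div_le_sum_range_add h0 h1 n]

theorem log_eq_log_div_sub_mul_log_two {y : ℝ} (hy : 0 < y) (k : ℕ) :
    Real.log y = Real.log ((1 + (2 ^ k * y - 1) / (2 ^ k * y + 1)) /
      (1 - (2 ^ k * y - 1) / (2 ^ k * y + 1))) - k * Real.log 2 := by
  have h : (1 + (2 ^ k * y - 1) / (2 ^ k * y + 1)) /
      (1 - (2 ^ k * y - 1) / (2 ^ k * y + 1)) = 2 ^ k * y := by
    have : 0 < 2 ^ k * y := by positivity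
    field_simp
    ring
  rw [h, Real.log_mul (by positivity) hy.ne', Real.log_pow]
  ring

/-- `log (hfun 0.454 ζ ξ)`, simplified by means of `6χ - 3/2 + 3ζ = 3 (2χ + ζ - 1/2)` and
`6χ - 3/2 - 9ζ = 3 (2χ - 3ζ - 1/2)`. -/
noncomputable def logHfun (ζ ξ : ℝ) : ℝ :=
  (1.132 - 4 * ζ) * Real.log 3 + ξ * (2 * Real.log 2 + Real.log (1 / 1.618))
    + 2 * ((0.408 + ζ) * Real.log (0.408 + ζ))
    + 2 * ((0.408 - 3 * ζ) * Real.log (0.408 - 3 * ζ))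
    + 1 / 2 * ((0.092 - 2 * ζ) * Real.log (0.092 - 2 * ζ))
    + 1 / 2 * ((0.092 + 4 * ζ) * Real.log (0.092 + 4 * ζ))
    - ξ * Real.log ξ
    - (0.092 - 2 * ζ - ξ) * Real.log (0.092 - 2 * ζ - ξ)
    - (0.092 + 4 * ζ - ξ) * Real.log (0.092 + 4 * ζ - ξ)
    - (1.04 - 5 * ζ + ξ) * Real.log (1.04 - 5 * ζ + ξ)

theorem rpow_self_eq_exp {y : ℝ} (hy : 0 ≤ y) : y ^ y = Real.exp (y * Real.log y) := by
  rcases hy.eq_or_lt with rfl | hy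
  · simp
  · rw [Real.rpow_def_of_pos hy, mul_comm]

theorem hfun_eq_exp_logHfun {ζ ξ : ℝ} (hζ0 : 0 ≤ ζ) (hζ1 : ζ ≤ 0.046)
    (hξ0 : 0 ≤ ξ) (hξ1 : ξ ≤ 0.092 - 2 * ζ) :
    hfun 0.454 ζ ξ = Real.exp (logHfun ζ ξ) := by
  have e1 : (1 - 2 * 0.454 - 2 * ζ : ℝ) = 0.092 - 2 * ζ := by ring
  have e2 : (1 - 2 * 0.454 + 4 * ζ : ℝ) = 0.092 + 4 * ζ := by ring
  have e3 : (6 * 0.454 - 3 / 2 + 3 * ζ : ℝ) = 3 * (0.408 + ζ) := by ring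
  have e4 : (6 * 0.454 - 3 / 2 - 9 * ζ : ℝ) = 3 * (0.408 - 3 * ζ) := by ring
  have e5 : (2 * 0.454 + ζ - 1 / 2 : ℝ) = 0.408 + ζ := by ring
  have e6 : (1 / 2 - 0.454 - ζ : ℝ) = (0.092 - 2 * ζ) / 2 := by ring
  have e7 : (1 / 2 - 0.454 + 2 * ζ : ℝ) = (0.092 + 4 * ζ) / 2 := by ring
  have e8 : (2 * 0.454 - 3 * ζ - 1 / 2 : ℝ) = 0.408 - 3 * ζ := by ring
  have e9 : (10 * 0.454 - 7 / 2 - 5 * ζ + ξ : ℝ) = 1.04 - 5 * ζ + ξ := by ring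
  have hE : 0 < 0.408 + ζ := by positivity
  have hF : 0 < 0.408 - 3 * ζ := by linarith
  have hB : 0 < 0.092 + 4 * ζ := by positivity
  have hA : 0 ≤ 0.092 - 2 * ζ := by linarith
  have hlogA : (0.092 - 2 * ζ) / 2 * Real.log ((0.092 - 2 * ζ) / 2) =
      (0.092 - 2 * ζ) / 2 * (Real.log (0.092 - 2 * ζ) - Real.log 2) := by
    rcases hA.eq_or_lt with h | h
    · simp [← h]
    · rw [Real.log_div h.ne' two_ne_zero]
  rw [hfun, ffun, gfun, e1, e2, e3, e4, e5, e6, e7, e8, e9,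
    rpow_self_eq_exp hA, rpow_self_eq_exp hB.le,
    rpow_self_eq_exp (show 0 ≤ 3 * (0.408 + ζ) by positivity),
    rpow_self_eq_exp (show 0 ≤ 3 * (0.408 - 3 * ζ) by positivity),
    rpow_self_eq_exp hE.le, rpow_self_eq_exp hF.le,
    rpow_self_eq_exp (show 0 ≤ (0.092 - 2 * ζ) / 2 by positivity),
    rpow_self_eq_exp (show 0 ≤ (0.092 + 4 * ζ) / 2 by positivity),
    rpow_self_eq_exp hξ0,
    rpow_self_eq_exp (show 0 ≤ 0.092 - 2 * ζ - ξ by linarith),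
    rpow_self_eq_exp (show 0 ≤ 0.092 + 4 * ζ - ξ by linarith),
    rpow_self_eq_exp (show 0 ≤ 1.04 - 5 * ζ + ξ by linarith),
    Real.rpow_def_of_pos three_pos, Real.rpow_def_of_pos two_pos, Real.rpow_def_of_pos two_pos,
    Real.rpow_def_of_pos (show (0 : ℝ) < 1 / 1.618 by norm_num)]
  simp only [← Real.exp_add, ← Real.exp_sub]
  rw [hlogA, Real.log_mul three_ne_zero hE.ne', Real.log_mul three_ne_zero hF.ne',
    Real.log_div hB.ne' two_ne_zero, logHfun]
  congr 1
  ring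

/-- The tangent plane of `logHfun` at `(0.0228718, 0.0142483)`, close to its maximum point, lies
above its graph. -/
theorem logHfun_le_tangent {ζ ξ : ℝ} (hζ0 : 0 ≤ ζ) (hζ1 : ζ ≤ 0.046)
    (hξ0 : 0 ≤ ξ) (hξ1 : ξ ≤ 0.092 - 2 * ζ) :
    logHfun ζ ξ ≤
      (1.132 - 4 * ζ) * Real.log 3 + ξ * (2 * Real.log 2 + Real.log (1 / 1.618))
        + 2 * ((0.408 + ζ) * Real.log 0.4308718)
        + 2 * ((0.408 - 3 * ζ) * Real.log 0.3393846)
        + 1 / 2 * ((0.092 - 2 * ζ) * Real.log 0.0462564)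
        + 1 / 2 * ((0.092 + 4 * ζ) * Real.log 0.1834872)
        - ξ * Real.log 0.0142483
        - (0.092 - 2 * ζ - ξ) * Real.log 0.0320081
        - (0.092 + 4 * ζ - ξ) * Real.log 0.1692389
        - (1.04 - 5 * ζ + ξ) * Real.log 0.9398893
        + (2 * ((0.408 + ζ) - 0.4308718) + 2 * ((0.408 - 3 * ζ) - 0.3393846)
        + 1 / 2 * ((0.092 - 2 * ζ) - 0.0462564) + 1 / 2 * ((0.092 + 4 * ζ) - 0.1834872)
        - (ξ - 0.0142483) - ((0.092 - 2 * ζ - ξ) - 0.0320081)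
        - ((0.092 + 4 * ζ - ξ) - 0.1692389) - ((1.04 - 5 * ζ + ξ) - 0.9398893)) := by
  have key := sum_mul_log_le_of_second_deriv_nonpos Finset.univ
    ![2, 2, 1 / 2, 1 / 2, -1, -1, -1, -1]
    ![0.4308718, 0.3393846, 0.0462564, 0.1834872, 0.0142483, 0.0320081, 0.1692389, 0.9398893]
    ![0.408 + ζ, 0.408 - 3 * ζ, 0.092 - 2 * ζ, 0.092 + 4 * ζ, ξ, 0.092 - 2 * ζ - ξ,
      0.092 + 4 * ζ - ξ, 1.04 - 5 * ζ + ξ]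
    (by
      intro i _
      fin_cases i <;> norm_num)
    (by
      intro i _
      fin_cases i <;> simp <;> linarith)
    (by
      rintro t ⟨ht0, ht1⟩
      have h1 : 0 ≤ 0.0228718 + t * (ζ - 0.0228718) := by nlinarith
      have h2 : 0 < 0.0142483 + t * (ξ - 0.0142483) := by nlinarith
      have h3 : 0 < 0.092 - 2 * (0.0228718 + t * (ζ - 0.0228718))
          - (0.0142483 + t * (ξ - 0.0142483)) := by nlinarith
      have h := entropy_hessian_nonpos h1 h2 h3 (ζ - 0.0228718) (ξ - 0.0142483)
      simp only [Fin.sum_univ_eight, Matrix.cons_val]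
      refine le_of_eq_of_le ?_ (sub_nonpos.2 h)
      ring_nf)
  simp only [Fin.sum_univ_eight, Matrix.cons_val] at key
  rw [logHfun]
  linarith

theorem logHfun_le {ζ ξ : ℝ} (hζ0 : 0 ≤ ζ) (hζ1 : ζ ≤ 0.046)
    (hξ0 : 0 ≤ ξ) (hξ1 : ξ ≤ 0.092 - 2 * ζ) :
    logHfun ζ ξ ≤ -0.000017001 := by
  have hlogE : Real.log 0.4308718 ≤ -0.841944675 := by
    rw [log_eq_log_div_sub_mul_log_two (by norm_num) 2]
    have := log_div_le_of_sum_le (x := (2 ^ 2 * 0.4308718 - 1) / (2 ^ 2 * 0.4308718 + 1))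
      (c := 0.5443496832) 9 (by norm_num) (by norm_num)
      (by norm_num [Finset.sum_range_succ])
    norm_num at this ⊢
    linarith [Real.log_two_gt_d9]
  have hlogF : Real.log 0.3393846 ≤ -1.080621295 := by
    rw [log_eq_log_div_sub_mul_log_two (by norm_num) 2]
    have := log_div_le_of_sum_le (x := (2 ^ 2 * 0.3393846 - 1) / (2 ^ 2 * 0.3393846 + 1))
      (c := 0.3056730627) 9 (by norm_num) (by norm_num)
      (by norm_num [Finset.sum_range_succ])
    norm_num at this ⊢
    linarith [Real.log_two_gt_d9]
  have hlogA : Real.log 0.0462564 ≤ -3.073555440 := by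
    rw [log_eq_log_div_sub_mul_log_two (by norm_num) 5]
    have := log_div_le_of_sum_le (x := (2 ^ 5 * 0.0462564 - 1) / (2 ^ 5 * 0.0462564 + 1))
      (c := 0.3921804596) 9 (by norm_num) (by norm_num)
      (by norm_num [Finset.sum_range_succ])
    norm_num at this ⊢
    linarith [Real.log_two_gt_d9]
  have hlogB : Real.log 0.1834872 ≤ -1.695610363 := by
    rw [log_eq_log_div_sub_mul_log_two (by norm_num) 3]
    have := log_div_le_of_sum_le (x := (2 ^ 3 * 0.1834872 - 1) / (2 ^ 3 * 0.1834872 + 1))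
      (c := 0.3838311760) 9 (by norm_num) (by norm_num)
      (by norm_num [Finset.sum_range_succ])
    norm_num at this ⊢
    linarith [Real.log_two_gt_d9]
  have hlogX : -4.251117684 ≤ Real.log 0.0142483 := by
    rw [log_eq_log_div_sub_mul_log_two (by norm_num) 7]
    have := le_log_div_of_le_sum (x := (2 ^ 7 * 0.0142483 - 1) / (2 ^ 7 * 0.0142483 + 1))
      (c := 0.6009125833) 9 (by norm_num) (by norm_num)
      (by norm_num [Finset.sum_range_succ])
    norm_num at this ⊢
    linarith [Real.log_two_lt_d9]
  have hlogAX : -3.441766289 ≤ Real.log 0.0320081 := by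
    rw [log_eq_log_div_sub_mul_log_two (by norm_num) 5]
    have := le_log_div_of_le_sum (x := (2 ^ 5 * 0.0320081 - 1) / (2 ^ 5 * 0.0320081 + 1))
      (c := 0.0239696166) 9 (by norm_num) (by norm_num)
      (by norm_num [Finset.sum_range_succ])
    norm_num at this ⊢
    linarith [Real.log_two_lt_d9]
  have hlogBX : -1.776443959 ≤ Real.log 0.1692389 := by
    rw [log_eq_log_div_sub_mul_log_two (by norm_num) 3]
    have := le_log_div_of_le_sum (x := (2 ^ 3 * 0.1692389 - 1) / (2 ^ 3 * 0.1692389 + 1))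
      (c := 0.3029975859) 9 (by norm_num) (by norm_num)
      (by norm_num [Finset.sum_range_succ])
    norm_num at this ⊢
    linarith [Real.log_two_lt_d9]
  have hlogG : -0.061993183 ≤ Real.log 0.9398893 := by
    rw [log_eq_log_div_sub_mul_log_two (by norm_num) 1]
    have := le_log_div_of_le_sum (x := (2 ^ 1 * 0.9398893 - 1) / (2 ^ 1 * 0.9398893 + 1))
      (c := 0.6311540009) 9 (by norm_num) (by norm_num)
      (by norm_num [Finset.sum_range_succ])
    norm_num at this ⊢
    linarith [Real.log_two_lt_d9]
  have hlog_three : Real.log (3 / 4) ≤ -0.287682066 := by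
    rw [log_eq_log_div_sub_mul_log_two (by norm_num) 1]
    have := log_div_le_of_sum_le (x := (2 ^ 1 * (3 / 4) - 1) / (2 ^ 1 * (3 / 4) + 1))
      (c := 0.4054651111) 9 (by norm_num) (by norm_num)
      (by norm_num [Finset.sum_range_succ])
    norm_num at this ⊢
    linarith [Real.log_two_gt_d9]
  have hlog_phi : Real.log (1 / 1.618) ≤ -0.481190813 := by
    rw [log_eq_log_div_sub_mul_log_two (by norm_num) 1]
    have := log_div_le_of_sum_le (x := (2 ^ 1 * (1 / 1.618) - 1) / (2 ^ 1 * (1 / 1.618) + 1))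
      (c := 0.2119563649) 9 (by norm_num) (by norm_num)
      (by norm_num [Finset.sum_range_succ])
    norm_num at this ⊢
    linarith [Real.log_two_gt_d9]
  have hlog3 : Real.log 3 = Real.log (3 / 4) + 2 * Real.log 2 := by
    rw [Real.log_div three_ne_zero four_ne_zero, show (4 : ℝ) = 2 ^ 2 by norm_num, Real.log_pow]
    push_cast
    ring
  have b1 := mul_le_mul_of_nonneg_left hlog_three (show 0 ≤ 1.132 - 4 * ζ by linarith)
  have b2 := mul_le_mul_of_nonneg_left hlog_phi hξ0
  have b3 := mul_le_mul_of_nonneg_left Real.log_two_lt_d9.le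
    (show 0 ≤ 1.132 - 4 * ζ + ξ by linarith)
  have b4 := mul_le_mul_of_nonneg_left hlogE (show 0 ≤ 0.408 + ζ by linarith)
  have b5 := mul_le_mul_of_nonneg_left hlogF (show 0 ≤ 0.408 - 3 * ζ by linarith)
  have b6 := mul_le_mul_of_nonneg_left hlogA (show 0 ≤ 0.092 - 2 * ζ by linarith)
  have b7 := mul_le_mul_of_nonneg_left hlogB (show 0 ≤ 0.092 + 4 * ζ by linarith)
  have b8 := mul_le_mul_of_nonneg_left hlogX hξ0
  have b9 := mul_le_mul_of_nonneg_left hlogAX (show 0 ≤ 0.092 - 2 * ζ - ξ by linarith)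
  have b10 := mul_le_mul_of_nonneg_left hlogBX (show 0 ≤ 0.092 + 4 * ζ - ξ by linarith)
  have b11 := mul_le_mul_of_nonneg_left hlogG (show 0 ≤ 1.04 - 5 * ζ + ξ by linarith)
  refine (logHfun_le_tangent hζ0 hζ1 hξ0 hξ1).trans ?_
  rw [hlog3]
  linarith

/-- for `0 ≤ ζ ≤ 0.046` and `0 ≤ ξ ≤ 0.092 − 2ζ`,
`h(0.454, ζ, ξ) ≤ 0.999983`. -/
theorem hfun_le_at_chi (ζ ξ : ℝ) (hζ0 : 0 ≤ ζ) (hζ1 : ζ ≤ 0.046)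
    (hξ0 : 0 ≤ ξ) (hξ1 : ξ ≤ 0.092 - 2 * ζ) :
    hfun 0.454 ζ ξ ≤ 0.999983 := by
  have h := logHfun_le hζ0 hζ1 hξ0 hξ1
  have hexp : 1.000017001 ≤ Real.exp (-logHfun ζ ξ) := by
    linarith [Real.add_one_le_exp (-logHfun ζ ξ)]
  rw [hfun_eq_exp_logHfun hζ0 hζ1 hξ0 hξ1, ← inv_inv (Real.exp _), ← Real.exp_neg]
  calc (Real.exp (-logHfun ζ ξ))⁻¹ ≤ (1.000017001)⁻¹ := by gcongr
    _ ≤ 0.999983 := by norm_num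
end
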